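/- For every integer d ≥ 3 there exists a simplicial complex Δ of dimension d − 1 (on 2d + 1 vertices) that is not a cone such that: (1) Δ is pure and shellable; (2) S/I_Δ^(2) is Cohen–Macaulay; (3) depth(S/I_Δ^(d+1)) = 1 and depth(S/I_Δ^(d+2)) ≥ 2; and (4) S_2-depth(S/I_Δ^(d+1)) = 1 and S_2-depth(S/I_Δ^(d+2)) ≥ 2. In particular, the depth and the S_2-Serre depth of the symbolic powers of a Stanley–Reisner ideal need not be non-increasing in ℓ, even when Δ is pure shellable and S/I_Δ^(2) is Cohen–Macaulay. -/

import Mathlib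

/-!
Common definitions for formalizing "The Serre depth of Stanley–Reisner rings and
the depth of their symbolic powers" (Muta–Terai).
-/

open CategoryTheory MvPolynomial

noncomputable section

namespace SerrePaper

/-! ### Simplicial complexes (given by their sets of faces) -/

variable {V : Type}

/-- A (nonempty, downward closed) abstract simplicial complex, given by its set of faces. -/
def IsComplex (K : Set (Finset V)) : Prop :=
  K.Nonempty ∧ ∀ F ∈ K, ∀ G ⊆ F, G ∈ K

/-- `F` is a facet (maximal face) of `K`. -/
def IsFacet (K : Set (Finset V)) (F : Finset V) : Prop :=
  F ∈ K ∧ ∀ G ∈ K, F ⊆ G → G = F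

/-- `K` is pure: all facets have the same cardinality. -/
def Pure (K : Set (Finset V)) : Prop :=
  ∀ F G : Finset V, IsFacet K F → IsFacet K G → F.card = G.card

/-- `dim K = d - 1`, i.e. the maximal cardinality of a face of `K` is `d`. -/
def HasDimCard (K : Set (Finset V)) (d : ℕ) : Prop :=
  (∃ F ∈ K, F.card = d) ∧ ∀ F ∈ K, F.card ≤ d

/-- the link of the face `F` in `K`. -/
def link [DecidableEq V] (K : Set (Finset V)) (F : Finset V) : Set (Finset V) :=
  { G | G ∪ F ∈ K ∧ G ∩ F = ∅ }

/-- `skeleton K t` is the `(t-1)`-skeleton `K^{t-1}` of `K`: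
all faces with at most `t` vertices. -/
def skeleton (K : Set (Finset V)) (t : ℕ) : Set (Finset V) :=
  { F ∈ K | F.card ≤ t }

/-- The Alexander dual complex `K^∨ = { F | complement of F is not a face of K }`. -/
def dualComplex [Fintype V] [DecidableEq V] (K : Set (Finset V)) : Set (Finset V) :=
  { F | Fᶜ ∉ K }

/-- The copy of `K` on its own vertex set (as a complex on the corresponding subtype). -/
def restrictVerts (K : Set (Finset V)) : Set (Finset {v : V // {v} ∈ K}) :=
  { F | F.map (Function.Embedding.subtype _) ∈ K }

/-- The induced subcomplex `K_W` on a subset `W` of the vertices. -/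
def inducedSub (K : Set (Finset V)) (W : Finset V) : Set (Finset V) :=
  { F ∈ K | F ⊆ W }

/-- `K` is a matroid complex: every induced subcomplex is pure. -/
def IsMatroidComplex (K : Set (Finset V)) : Prop :=
  ∀ W : Finset V, Pure (inducedSub K W)

/-! ### Reduced simplicial homology with coefficients in a field `k` -/

/-- The group of simplicial `(c-1)`-chains: formal `k`-linear combinations of the
faces of `K` with exactly `c` vertices. -/
abbrev chainGroup (k : Type) [Field k] (K : Set (Finset V)) (c : ℕ) : Type :=
  {F : Finset V // F ∈ K ∧ F.card = c} →₀ k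

open Classical in
/-- the boundary of a single face, `∂F = ∑_{x ∈ F} (-1)^{pos of x in F} (F \ {x})`. -/
def boundaryAt (k : Type) [Field k] [LinearOrder V] (K : Set (Finset V)) (c : ℕ)
    (F : {F : Finset V // F ∈ K ∧ F.card = c + 1}) : chainGroup k K c :=
  ∑ x ∈ F.1.attach,
    if h : F.1.erase x.1 ∈ K then
      Finsupp.single
        ⟨F.1.erase x.1, h, by simp [Finset.card_erase_of_mem x.2, F.2.2]⟩
        ((-1 : k) ^ (F.1.filter (fun y => y < x.1)).card)
    else 0

/-- The simplicial boundary map (for a downward closed `K` this is the usual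
boundary map of the reduced (augmented) chain complex of `K`, where faces with
`c` vertices sit in homological degree `c - 1`). -/
def boundary (k : Type) [Field k] [LinearOrder V] (K : Set (Finset V)) (c : ℕ) :
    chainGroup k K (c + 1) →ₗ[k] chainGroup k K c :=
  Finsupp.lsum k fun F => LinearMap.toSpanSingleton k _ (boundaryAt k K c F)

/-- `H̃ᵢ(K; k) = 0`: every reduced `i`-cycle is a boundary.  (For `i ≤ -2` this holds
trivially; for `i = -1` the relevant cycle group is the whole of the `(-1)`-chains.) -/
def reducedHomologyVanishes (k : Type) [Field k] [LinearOrder V]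
    (K : Set (Finset V)) (i : ℤ) : Prop :=
  if i < -1 then True
  else if i = -1 then
    ∀ z : chainGroup k K 0, ∃ b : chainGroup k K 1, boundary k K 0 b = z
  else
    ∀ z : chainGroup k K (i.toNat + 1), boundary k K i.toNat z = 0 →
      ∃ b : chainGroup k K (i.toNat + 2), boundary k K (i.toNat + 1) b = z

/-- Nonvanishing `β_{i,j}(k[K]) ≠ 0` of the graded Betti numbers of the
Stanley–Reisner ring of `K`, expressed via Hochster's formula:
`β_{i,j}(k[K]) = ∑_{W ⊆ V, |W| = j} dim_k H̃_{j-i-1}(K_W; k)`. -/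
def bettiNonzero (k : Type) [Field k] [LinearOrder V] (K : Set (Finset V)) (i j : ℕ) : Prop :=
  ∃ W : Finset V, W.card = j ∧
    ¬ reducedHomologyVanishes k (inducedSub K W) ((j : ℤ) - i - 1)

/-- `reg_{≤ r} I_K = max{ j : β_{i,i+j}(I_K) ≠ 0 for some i ≤ r }`, where
`β_{i,d}(I_K) = β_{i+1,d}(k[K])`. -/
def regLEIdeal (k : Type) [Field k] [LinearOrder V] (K : Set (Finset V)) (r : ℕ) : ℕ :=
  sSup { j : ℕ | ∃ i ≤ r, bettiNonzero k K (i + 1) (i + j) }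

/-- `indeg I_K`: the least degree of a minimal generator of the Stanley–Reisner
ideal of `K`, i.e. `min{ j : β_{0,j}(I_K) = β_{1,j}(k[K]) ≠ 0 }`. -/
def indegIdeal (k : Type) [Field k] [LinearOrder V] (K : Set (Finset V)) : ℕ :=
  sInf { j : ℕ | bettiNonzero k K 1 j }

/-! ### Stanley–Reisner rings, Serre depth, depth, symbolic powers -/

variable (k : Type) [Field k]

/-- The Stanley–Reisner ideal of `K` (generated by the monomials of the non-faces,
equivalently by those of the minimal non-faces). -/
def srIdeal (K : Set (Finset V)) : Ideal (MvPolynomial V k) :=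
  Ideal.span { m | ∃ F : Finset V, F ∉ K ∧ m = ∏ i ∈ F, X i }

/-- The homogeneous maximal ideal `(x_v : v ∈ V)` of the polynomial ring. -/
def maxIdeal (V : Type) : Ideal (MvPolynomial V k) :=
  Ideal.span (Set.range X)

/-- The quotient ring `S/I` as an object of `ModuleCat S`. -/
def quotMod {V : Type} (I : Ideal (MvPolynomial V k)) : ModuleCat (MvPolynomial V k) :=
  ModuleCat.of _ (MvPolynomial V k ⧸ I)

/-- The Stanley–Reisner ring `k[K] = S/I_K` as a module over `S`. -/
def srRing (K : Set (Finset V)) : ModuleCat (MvPolynomial V k) :=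
  quotMod k (srIdeal k K)

/-- The Krull dimension of a module, `dim M = dim (R / ann M)` (so `dim 0 = ⊥ = -∞`). -/
def modDim {R : Type} [CommRing R] (M : ModuleCat R) : WithBot ℕ∞ :=
  ringKrullDim (R ⧸ Module.annihilator R M)

/-- `Ext_R^i(M, N)` as an `R`-module. -/
def extM {R : Type} [CommRing R] (M N : ModuleCat R) (i : ℕ) : ModuleCat R :=
  ((Ext R (ModuleCat R) i).obj (Opposite.op M)).obj N

/-- `K_M^j = Ext_S^{n-j}(M, ω_S)`, the (Matlis dual of) local cohomology; since the
canonical module `ω_S` of the polynomial ring `S` is `S` itself up to a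
grading shift, we use `Ext_S^{n-j}(M, S)`. -/
def serreK {V : Type} (M : ModuleCat (MvPolynomial V k)) (j : ℕ) :
    ModuleCat (MvPolynomial V k) :=
  extM M (ModuleCat.of _ (MvPolynomial V k)) (Nat.card V - j)

/-- The Serre depth `S_r-depth(M) = min{ j : dim K_M^j ≥ j - r + 1 }`.
(Note that, since `dim K_M^j` is either `⊥` or `≥ 0`, the inequality
`dim K_M^j ≥ j - r + 1` of (possibly negative) integers is equivalent to
`(j + 1 - r : ℕ) ≤ dim K_M^j` with truncated subtraction.) -/
def serreDepth {V : Type} (r : ℕ) (M : ModuleCat (MvPolynomial V k)) : ℕ :=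
  sInf { j : ℕ | ((j + 1 - r : ℕ) : WithBot ℕ∞) ≤ modDim (serreK k M j) }

/-- Serre's condition `(S_r)` for an unmixed module: `S_r-depth(M) = dim M`. -/
def serreCond {V : Type} (r : ℕ) (M : ModuleCat (MvPolynomial V k)) : Prop :=
  (serreDepth k r M : WithBot ℕ∞) = modDim M

/-- The depth of `M` with respect to the homogeneous maximal ideal,
via Rees' characterization `depth M = min{ i : Ext^i(S/m, M) ≠ 0 }`. -/
def mdepth {V : Type} (M : ModuleCat (MvPolynomial V k)) : ℕ :=
  sInf { i : ℕ | Nontrivial (extM (quotMod k (maxIdeal k V)) M i) }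

/-- `M` is Cohen–Macaulay: `depth M = dim M`. -/
def isCM {V : Type} (M : ModuleCat (MvPolynomial V k)) : Prop :=
  (mdepth k M : WithBot ℕ∞) = modDim M

/-- The `ℓ`-th symbolic power of a (radical, e.g. squarefree monomial) ideal:
`I^(ℓ) = ⋂_{P ∈ Min(I)} P^ℓ`. -/
def symbPow {R : Type} [CommRing R] (I : Ideal R) (ℓ : ℕ) : Ideal R :=
  sInf { J | ∃ P ∈ I.minimalPrimes, J = P ^ ℓ }

/-- The height of an ideal: the Krull dimension of the poset of primes contained in it. -/
def idealHeight {R : Type} [CommRing R] (p : Ideal R) : WithBot ℕ∞ :=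
  Order.krullDim { q : PrimeSpectrum R // q.asIdeal ≤ p }

/-- `R/I` is unmixed: all associated primes of `R/I` have the same height. -/
def IsUnmixedIdeal {R : Type} [CommRing R] (I : Ideal R) : Prop :=
  ∀ p q : Ideal R, p ∈ associatedPrimes R (R ⧸ I) → q ∈ associatedPrimes R (R ⧸ I) →
    idealHeight p = idealHeight q

/-- Nonvanishing of the first local cohomology `H_m^1(S/I) ≠ 0`. -/
def H1NE {V : Type} (I : Ideal (MvPolynomial V k)) : Prop :=
  Nontrivial ((localCohomology (maxIdeal k V) 1).obj (quotMod k I))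

/-- `I` is a squarefree monomial ideal. -/
def IsSqFreeMonomialIdeal {V : Type} (I : Ideal (MvPolynomial V k)) : Prop :=
  ∃ G : Set (Finset V), I = Ideal.span ((fun F => ∏ i ∈ F, X i) '' G)

end SerrePaper

end
namespace SerrePaper

/-- `K` is shellable: its facets can be ordered `F_0, …, F_{m-1}` so that for each
`j ≥ 1` the complex `⟨F_0, …, F_{j-1}⟩ ∩ ⟨F_j⟩` is pure of dimension `dim F_j - 1`,
i.e. all its facets have exactly `|F_j| - 1` vertices. -/
def Shellable {V : Type} (K : Set (Finset V)) : Prop :=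
  ∃ (m : ℕ) (f : Fin m → Finset V), Function.Injective f ∧
    (∀ F : Finset V, IsFacet K F ↔ ∃ i, f i = F) ∧
    ∀ j : Fin m, 0 < (j : ℕ) →
      ∀ G : Finset V,
        IsFacet {G' : Finset V | G' ⊆ f j ∧ ∃ i : Fin m, (i : ℕ) < (j : ℕ) ∧ G' ⊆ f i} G →
          G.card + 1 = (f j).card

lemma ProjectiveResolution_extMk_eq_zero_iff_of_prev {R : Type} [CommRing R] {M N : ModuleCat.{0} R}
    (P : ProjectiveResolution M) (i : ℕ) (f : P.complex.X i ⟶ N)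
    (hf : P.complex.d (i + 1) i ≫ f = 0) :
    P.extMk f (i + 1) rfl hf = 0 ↔
      ∃ g : P.complex.X ((ComplexShape.up ℕ).prev i) ⟶ N,
        P.complex.d i ((ComplexShape.up ℕ).prev i) ≫ g = f := by
  cases i with
  | succ p =>
    rw [CochainComplex.prev_nat_succ]
    exact P.extMk_eq_zero_iff f _ rfl hf p rfl
  | zero =>
    rw [CochainComplex.prev_nat_zero, P.complex.shape 0 0 (by simp)]
    simp only [Limits.zero_comp, exists_const]
    rw [← P.extEquivCohomologyClass.apply_eq_iff_eq,
      P.extEquivCohomologyClass_extMk, P.extEquivCohomologyClass_zero,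
      CochainComplex.HomComplex.CohomologyClass.mk_eq_zero_iff,
      CochainComplex.HomComplex.Cocycle.toSingleMk_mem_coboundaries_iff _ _ _ _ _ 1 (by simp)]
    have hz : Limits.IsZero (P.cochainComplex.X 1) :=
      P.cochainComplex.isZero_of_isStrictlyLE 0 1
    constructor
    · rintro ⟨g, hg⟩
      rw [hz.eq_of_src g 0, Limits.comp_zero] at hg
      exact ((cancel_epi (P.cochainComplexXIso (-(0 : ℕ)) 0 rfl).hom).1
        (by rw [← hg, Limits.comp_zero])).symm
    · rintro rfl
      exact ⟨0, by simp⟩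

/-- The part around degree `i` of the complex computing `Ext` by a projective resolution. -/
noncomputable def extShortComplex {R : Type} [CommRing R] {M : ModuleCat.{0} R}
    (P : ProjectiveResolution M) (N : ModuleCat.{0} R) (i : ℕ) : ShortComplex (ModuleCat.{0} R) :=
  (P.complex.linearYonedaObj R N).sc' ((ComplexShape.up ℕ).prev i) i (i + 1)

/-- The elements of `Abelian.Ext` represented by the cocycles of a projective resolution. -/
noncomputable def extOfCocycle {R : Type} [CommRing R] {M N : ModuleCat.{0} R}
    (P : ProjectiveResolution M) (i : ℕ) :
    LinearMap.ker (extShortComplex P N i).g.hom →ₗ[R] Abelian.Ext M N i where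
  toFun f := P.extMk (show P.complex.X i ⟶ N from f.1) (i + 1) rfl f.2
  map_add' f g := (P.add_extMk (show P.complex.X i ⟶ N from f.1)
    (show P.complex.X i ⟶ N from g.1) (i + 1) rfl f.2 g.2).symm
  map_smul' r f := by
    have h := P.extMk_comp_mk₀ (show P.complex.X i ⟶ N from f.1) (i + 1) rfl f.2 (r • 𝟙 N)
    have h' := Abelian.Ext.smul_eq_comp_mk₀
      (P.extMk (show P.complex.X i ⟶ N from f.1) (i + 1) rfl f.2) r
    refine Eq.trans ?_ (h.symm.trans h'.symm)
    congr 1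


/-- `extM` agrees with Mathlib's `Abelian.Ext`. -/
theorem extM_linearEquiv {R : Type} [CommRing R] (M N : ModuleCat.{0} R) (i : ℕ) :
    Nonempty (extM M N i ≃ₗ[R] Abelian.Ext M N i) := by
  let P := ProjectiveResolution.of M
  let C := P.complex.linearYonedaObj R N
  let p := (ComplexShape.up ℕ).prev i
  have hq : (ComplexShape.up ℕ).next i = i + 1 := by simp
  let T := extShortComplex P N i
  let e1 : extM M N i ≅ T.moduleCatLeftHomologyData.H :=
    P.isoExt i N ≪≫ ShortComplex.homologyMapIso (C.isoSc' p i (i + 1) rfl hq) ≪≫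
      T.moduleCatHomologyIso
  have hs : Function.Surjective (extOfCocycle (N := N) P i) := by
    intro x
    obtain ⟨f, hf, rfl⟩ := P.extMk_surjective x (i + 1) rfl
    exact ⟨⟨f, hf⟩, rfl⟩
  have hk : LinearMap.range T.moduleCatToCycles = LinearMap.ker (extOfCocycle (N := N) P i) := by
    ext f
    rw [LinearMap.mem_ker]
    refine Iff.trans ?_ (ProjectiveResolution_extMk_eq_zero_iff_of_prev P i f.1 f.2).symm
    constructor
    · rintro ⟨g, hg⟩
      exact ⟨g, congrArg Subtype.val hg⟩
    · rintro ⟨g, hg⟩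
      exact ⟨g, Subtype.ext hg⟩
  exact ⟨e1.toLinearEquiv.trans ((Submodule.quotEquivOfEq _ _ hk).trans
    ((extOfCocycle P i).quotKerEquivOfSurjective hs))⟩

section ExtSequences

variable {R : Type} [CommRing R] {A B C T : Type} [AddCommGroup A] [Module R A]
  [AddCommGroup B] [Module R B] [AddCommGroup C] [Module R C] [AddCommGroup T] [Module R T]

variable (R) in
/-- Mathlib's `Ext`-groups for unbundled modules. -/
abbrev ModExt (M N : Type) [AddCommGroup M] [Module R M] [AddCommGroup N] [Module R N]
    (i : ℕ) : Type :=
  Abelian.Ext (ModuleCat.of R M) (ModuleCat.of R N) i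

/-- A short exact sequence of unbundled modules. -/
structure IsSES (f : A →ₗ[R] B) (g : B →ₗ[R] C) : Prop where
  inj : Function.Injective f
  exact : Function.Exact f g
  surj : Function.Surjective g

/-- The short complex attached to a short exact sequence of unbundled modules. -/
abbrev IsSES.shortComplex {f : A →ₗ[R] B} {g : B →ₗ[R] C} (h : IsSES f g) :
    ShortComplex (ModuleCat.{0} R) :=
  ShortComplex.mk (ModuleCat.ofHom f) (ModuleCat.ofHom g) (by
    ext x
    exact h.exact.apply_apply_eq_zero x)

lemma IsSES.shortExact {f : A →ₗ[R] B} {g : B →ₗ[R] C} (h : IsSES f g) :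
    h.shortComplex.ShortExact where
  exact := (ShortComplex.ShortExact.moduleCat_exact_iff_function_exact _).2 h.exact
  mono_f := (ModuleCat.mono_iff_injective _).2 h.inj
  epi_g := (ModuleCat.epi_iff_surjective _).2 h.surj

lemma isSES_mkQ (N : Submodule R B) : IsSES N.subtype N.mkQ :=
  ⟨N.subtype_injective, LinearMap.exact_subtype_mkQ N, N.mkQ_surjective⟩

lemma isSES_range {f : A →ₗ[R] B} (hf : Function.Injective f) :
    IsSES f (LinearMap.range f).mkQ :=
  ⟨hf, LinearMap.exact_map_mkQ_range f, Submodule.mkQ_surjective _⟩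

lemma isSES_ker {g : B →ₗ[R] C} (hg : Function.Surjective g) :
    IsSES (LinearMap.ker g).subtype g :=
  ⟨Submodule.subtype_injective _, LinearMap.exact_subtype_ker_map g, hg⟩

variable {f : A →ₗ[R] B} {g : B →ₗ[R] C}

lemma subsingleton_of_forall_eq_zero {G : Type} [AddCommGroup G] (h : ∀ x : G, x = 0) :
    Subsingleton G :=
  subsingleton_of_forall_eq 0 h

lemma IsSES.ext_middle (h : IsSES f g) {i : ℕ} (hA : Subsingleton (ModExt R T A i))
    (hC : Subsingleton (ModExt R T C i)) : Subsingleton (ModExt R T B i) := by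
  refine subsingleton_of_forall_eq_zero fun x => ?_
  obtain ⟨y, rfl⟩ := Abelian.Ext.covariant_sequence_exact₂ _ h.shortExact x (Subsingleton.elim _ _)
  rw [Subsingleton.elim y 0, Abelian.Ext.zero_comp]

lemma IsSES.ext_right (h : IsSES f g) {i : ℕ} (hB : Subsingleton (ModExt R T B i))
    (hA : Subsingleton (ModExt R T A (i + 1))) : Subsingleton (ModExt R T C i) := by
  refine subsingleton_of_forall_eq_zero fun x => ?_
  obtain ⟨y, rfl⟩ := Abelian.Ext.covariant_sequence_exact₃ _ h.shortExact x rfl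
    (Subsingleton.elim _ _)
  rw [Subsingleton.elim y 0, Abelian.Ext.zero_comp]

lemma IsSES.ext_left_succ (h : IsSES f g) {i : ℕ} (hC : Subsingleton (ModExt R T C i))
    (hB : Subsingleton (ModExt R T B (i + 1))) : Subsingleton (ModExt R T A (i + 1)) := by
  refine subsingleton_of_forall_eq_zero fun x => ?_
  obtain ⟨y, rfl⟩ := Abelian.Ext.covariant_sequence_exact₁ _ h.shortExact x
    (Subsingleton.elim _ _) rfl
  rw [Subsingleton.elim y 0, Abelian.Ext.zero_comp]

lemma IsSES.ext_left_zero (h : IsSES f g) (hB : Subsingleton (ModExt R T B 0)) :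
    Subsingleton (ModExt R T A 0) := by
  have := h.shortExact.mono_f
  refine subsingleton_of_forall_eq_zero fun x => ?_
  exact (Abelian.Ext.postcomp_mk₀_injective_of_mono _ h.shortComplex.f)
    (hB.elim (x.comp (Abelian.Ext.mk₀ h.shortComplex.f) (add_zero 0)) _)

lemma IsSES.ext_middle' (h : IsSES f g) {i : ℕ} (hA : Subsingleton (ModExt R A T i))
    (hC : Subsingleton (ModExt R C T i)) : Subsingleton (ModExt R B T i) := by
  refine subsingleton_of_forall_eq_zero fun x => ?_
  obtain ⟨y, rfl⟩ := Abelian.Ext.contravariant_sequence_exact₂ h.shortExact _ x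
    (Subsingleton.elim _ _)
  rw [Subsingleton.elim y 0, Abelian.Ext.comp_zero]

lemma IsSES.ext_left' (h : IsSES f g) {i : ℕ} (hB : Subsingleton (ModExt R B T i))
    (hC : Subsingleton (ModExt R C T (i + 1))) : Subsingleton (ModExt R A T i) := by
  refine subsingleton_of_forall_eq_zero fun x => ?_
  obtain ⟨y, rfl⟩ := Abelian.Ext.contravariant_sequence_exact₁ h.shortExact _ x (add_comm 1 i)
    (Subsingleton.elim _ _)
  rw [Subsingleton.elim y 0, Abelian.Ext.comp_zero]

lemma IsSES.ext_right_succ' (h : IsSES f g) {i : ℕ} (hA : Subsingleton (ModExt R A T i))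
    (hB : Subsingleton (ModExt R B T (i + 1))) : Subsingleton (ModExt R C T (i + 1)) := by
  refine subsingleton_of_forall_eq_zero fun x => ?_
  obtain ⟨y, rfl⟩ := Abelian.Ext.contravariant_sequence_exact₃ h.shortExact _ x
    (Subsingleton.elim _ _) (add_comm 1 i)
  rw [Subsingleton.elim y 0, Abelian.Ext.comp_zero]

end ExtSequences

section GlobalDimension

open scoped Polynomial TensorProduct

variable {R : Type} [CommRing R]

lemma IsSES.baseChange {A B C : Type} [AddCommGroup A] [Module R A] [AddCommGroup B] [Module R B]
    [AddCommGroup C] [Module R C] {f : A →ₗ[R] B} {g : B →ₗ[R] C} (h : IsSES f g)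
    (R' : Type) [CommRing R'] [Algebra R R'] [Module.Flat R R'] :
    IsSES (f.baseChange R') (g.baseChange R') :=
  ⟨Module.Flat.lTensor_preserves_injective_linearMap _ h.inj,
    lTensor_exact R' h.exact h.surj, LinearMap.lTensor_surjective R' h.surj⟩

lemma hasProjectiveDimensionLE_baseChange {A : Type} [CommRing A] [Algebra R A] [Module.Flat R A]
    (m : ℕ) (N : Type) [AddCommGroup N] [Module R N]
    (hN : HasProjectiveDimensionLE (ModuleCat.of R N) m) :
    HasProjectiveDimensionLE (ModuleCat.of A (A ⊗[R] N)) m := by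
  induction m generalizing N with
  | zero =>
    rw [← projective_iff_hasProjectiveDimensionLE_zero, ← IsProjective.iff_projective] at hN ⊢
    infer_instance
  | succ m ih =>
    let p : (N →₀ R) →ₗ[R] N := Finsupp.linearCombination R id
    have hp : Function.Surjective p := Finsupp.linearCombination_id_surjective R N
    have h1 := isSES_ker hp
    have hk : HasProjectiveDimensionLE (ModuleCat.of R (LinearMap.ker p)) m := by
      refine (h1.shortExact.hasProjectiveDimensionLT_X₃_iff m ?_).1 hN
      exact (IsProjective.iff_projective (N →₀ R)).1 inferInstance
    have h2 := h1.baseChange A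
    refine (h2.shortExact.hasProjectiveDimensionLT_X₃_iff m ?_).2 (ih _ hk)
    exact (IsProjective.iff_projective (A ⊗[R] (N →₀ R))).1 inferInstance

section

variable (N : Type) [AddCommGroup N] [Module R N] [Module R[X] N] [IsScalarTower R R[X] N]

/-- Multiplication by `X` as an `R`-linear endomorphism. -/
noncomputable def mulX : N →ₗ[R] N := (LinearMap.lsmul R[X] N Polynomial.X).restrictScalars R

/-- The `R[X]`-linear map `X ⊗ 1 - 1 ⊗ X`. -/
noncomputable def charMap : R[X] ⊗[R] N →ₗ[R[X]] R[X] ⊗[R] N :=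
  (Polynomial.X : R[X]) • LinearMap.id - (mulX (R := R) N).baseChange R[X]

/-- The `R[X]`-linear action map. -/
noncomputable def actMap : R[X] ⊗[R] N →ₗ[R[X]] N :=
  LinearMap.liftBaseChange R[X] LinearMap.id

lemma charMap_isSES : IsSES (charMap (R := R) N) (actMap N) := by
  have hsurj : Function.Surjective (actMap (R := R) N) := fun n =>
    ⟨1 ⊗ₜ n, by simp [actMap]⟩
  have hcomp : ∀ t, actMap N (charMap (R := R) N t) = 0 := by
    intro t
    induction t with
    | zero => simp
    | add a b ha hb => simp [ha, hb]
    | tmul p n =>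
      simp [actMap, charMap, mulX, TensorProduct.smul_tmul', smul_smul, mul_comm]
  have hmem : ∀ t, t - 1 ⊗ₜ (actMap N t) ∈ LinearMap.range (charMap (R := R) N) := by
    intro t
    induction t with
    | zero => simp
    | add a b ha hb =>
      rw [map_add, TensorProduct.tmul_add, add_sub_add_comm]
      exact Submodule.add_mem _ ha hb
    | tmul p n =>
      induction p using Polynomial.induction_on generalizing n with
      | C a => 
        have : (Polynomial.C a : R[X]) ⊗ₜ[R] n = 1 ⊗ₜ (a • n) := by
          rw [← TensorProduct.smul_tmul, Polynomial.smul_eq_C_mul, mul_one]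
        simp [actMap, this, TensorProduct.tmul_smul]
      | add p q hp hq =>
        rw [TensorProduct.add_tmul, map_add, TensorProduct.tmul_add, add_sub_add_comm]
        exact Submodule.add_mem _ (hp n) (hq n)
      | monomial i a ih =>
        have h1 := ih ((Polynomial.X : R[X]) • n)
        have h2 : (Polynomial.C a * Polynomial.X ^ (i + 1) : R[X]) ⊗ₜ[R] n - (Polynomial.C a * Polynomial.X ^ i : R[X]) ⊗ₜ[R] ((Polynomial.X : R[X]) • n)
            ∈ LinearMap.range (charMap (R := R) N) := by
          refine ⟨(Polynomial.C a * Polynomial.X ^ i : R[X]) ⊗ₜ n, ?_⟩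
          simp [charMap, mulX, TensorProduct.smul_tmul', pow_succ']
          ring_nf
        have := Submodule.add_mem _ h2 h1
        simp only [sub_add_sub_cancel] at this
        convert this using 3
        simp [actMap, smul_smul, pow_succ, mul_assoc]
  refine ⟨?_, ?_, hsurj⟩
  · let e := PolynomialModule.polynomialTensorProductLEquivPolynomialModule R N
    have hc : ∀ t i, (e ((mulX (R := R) N).baseChange R[X] t)).coeff i
        = (Polynomial.X : R[X]) • (e t).coeff i := by
      intro t i
      induction t with
      | zero => simp
      | add a b ha hb => simp only [map_add, PolynomialModule.coeff_add, Finsupp.add_apply, ha, hb, smul_add]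
      | tmul p n =>
        have he : ∀ m : N, e (p ⊗ₜ m) = p • PolynomialModule.single R 0 m := fun m => by
          simp [e, PolynomialModule.polynomialTensorProductLEquivPolynomialModule,
            PolynomialModule.lsingle]
        rw [LinearMap.baseChange_tmul, he, he]
        simp only [PolynomialModule.smul_single_apply, zero_le, if_true]
        exact smul_comm _ _ _
    rw [injective_iff_map_eq_zero]
    intro t ht
    have h1 : ∀ i, (e t).coeff i = (Polynomial.X : R[X]) • (e t).coeff (i + 1) := by
      intro i
      have h : (Polynomial.X : R[X]) • e t = e ((mulX (R := R) N).baseChange R[X] t) := by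
        have := congrArg e ht
        simpa only [charMap, LinearMap.sub_apply, LinearMap.smul_apply, LinearMap.id_apply,
          map_sub, map_smul, map_zero, sub_eq_zero] using this
      have h2 : ((Polynomial.X : R[X]) • e t).coeff (i + 1) = (e t).coeff i := by
        rw [← Polynomial.monomial_one_one_eq_X, PolynomialModule.monomial_smul_apply]
        simp
      rw [← hc, ← h2, h]
    have h2 : ∀ j i, (e t).coeff i = (Polynomial.X : R[X]) ^ j • (e t).coeff (i + j) := by
      intro j
      induction j with
      | zero => simp
      | succ j ih =>
        intro i
        rw [ih, h1 (i + j), smul_smul, pow_succ, add_assoc]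
    refine e.injective ?_
    rw [map_zero]
    refine PolynomialModule.coeff_injective ?_
    ext i
    obtain ⟨j, hj⟩ := (e t).coeff.support.exists_nat_subset_range
    rw [h2 j i, Finsupp.notMem_support_iff.1 (fun h => by simpa using hj h), smul_zero]
    rfl
  · intro t
    constructor
    · intro ht
      have := hmem t
      rwa [ht, TensorProduct.tmul_zero, sub_zero] at this
    · rintro ⟨u, rfl⟩
      exact hcomp u

lemma hasProjectiveDimensionLE_polynomial {m : ℕ}
    (h : ∀ (N : Type) [AddCommGroup N] [Module R N],
      HasProjectiveDimensionLE (ModuleCat.of R N) m) :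
    HasProjectiveDimensionLE (ModuleCat.of R[X] N) (m + 1) :=
  (charMap_isSES (R := R) N).shortExact.hasProjectiveDimensionLT_X₃ (m + 1)
    (hasProjectiveDimensionLE_baseChange m N (h N))
    (have := hasProjectiveDimensionLE_baseChange (A := R[X]) m N (h N)
     hasProjectiveDimensionLT_of_ge _ (m + 1) _ (by lia))

end

/-- Hilbert's syzygy theorem, in the form of a bound on projective dimensions. -/
theorem hasProjectiveDimensionLE_mvPolynomial (k : Type) [Field k] (n : ℕ) :
    ∀ (N : Type) [AddCommGroup N] [Module (MvPolynomial (Fin n) k) N],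
      HasProjectiveDimensionLE (ModuleCat.of (MvPolynomial (Fin n) k) N) n := by
  induction n with
  | zero =>
    intro N _ _
    let e : k ≃+* MvPolynomial (Fin 0) k := (MvPolynomial.isEmptyRingEquiv k (Fin 0)).symm
    let _ : Module k N := Module.compHom N e.toRingHom
    have h₁ := RingHomInvPair.of_ringEquiv e
    have h₂ := RingHomInvPair.of_ringEquiv e.symm
    let e' : N ≃ₛₗ[RingHomClass.toRingHom e] N :=
      { AddEquiv.refl N with map_smul' := fun _ _ => rfl }
    have : HasProjectiveDimensionLE (ModuleCat.of k N) 0 := by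
      rw [← projective_iff_hasProjectiveDimensionLE_zero, ← IsProjective.iff_projective]
      infer_instance
    exact ModuleCat.hasProjectiveDimensionLE_of_semiLinearEquiv (M := ModuleCat.of k N)
      (N := ModuleCat.of (MvPolynomial (Fin 0) k) N) e e' 0
  | succ n ih =>
    intro N _ _
    let e : (MvPolynomial (Fin n) k)[X] ≃+* MvPolynomial (Fin (n + 1)) k :=
      (MvPolynomial.finSuccEquiv k n).symm.toRingEquiv
    let _ : Module (MvPolynomial (Fin n) k)[X] N := Module.compHom N e.toRingHom
    let _ : Module (MvPolynomial (Fin n) k) N :=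
      Module.compHom N (Polynomial.C : MvPolynomial (Fin n) k →+* _)
    have : IsScalarTower (MvPolynomial (Fin n) k) (MvPolynomial (Fin n) k)[X] N :=
      ⟨fun a b x => by rw [Polynomial.smul_eq_C_mul, mul_smul]; rfl⟩
    have h₁ := RingHomInvPair.of_ringEquiv e
    have h₂ := RingHomInvPair.of_ringEquiv e.symm
    let e' : N ≃ₛₗ[RingHomClass.toRingHom e] N :=
      { AddEquiv.refl N with map_smul' := fun _ _ => rfl }
    have : HasProjectiveDimensionLE (ModuleCat.of (MvPolynomial (Fin n) k)[X] N) (n + 1) :=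
      hasProjectiveDimensionLE_polynomial N fun N _ _ => ih N
    exact ModuleCat.hasProjectiveDimensionLE_of_semiLinearEquiv
      (M := ModuleCat.of (MvPolynomial (Fin n) k)[X] N)
      (N := ModuleCat.of (MvPolynomial (Fin (n + 1)) k) N) e e' (n + 1)

lemma subsingleton_modExt_of_lt (k : Type) [Field k] (n : ℕ) (M N : Type)
    [AddCommGroup M] [Module (MvPolynomial (Fin n) k) M]
    [AddCommGroup N] [Module (MvPolynomial (Fin n) k) N] {i : ℕ} (hi : n < i) :
    Subsingleton (ModExt (MvPolynomial (Fin n) k) M N i) :=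
  have := hasProjectiveDimensionLE_mvPolynomial k n M
  HasProjectiveDimensionLT.subsingleton _ (n + 1) i hi _

end GlobalDimension

section MonomialIdeals

variable {V : Type} (k : Type) [Field k]

/-- The ideal spanned by the monomials with exponents in `U`. -/
noncomputable def monIdeal (U : Set (V →₀ ℕ)) : Ideal (MvPolynomial V k) :=
  Ideal.span ((fun b => monomial b (1 : k)) '' U)

/-- The quotient of the polynomial ring by a monomial ideal. -/
abbrev MonQuot (U : Set (V →₀ ℕ)) : Type := MvPolynomial V k ⧸ monIdeal k U

variable {k}

lemma mem_monIdeal {U : Set (V →₀ ℕ)} (hU : IsUpperSet U) {f : MvPolynomial V k} :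
    f ∈ monIdeal k U ↔ ∀ b ∈ f.support, b ∈ U := by
  rw [monIdeal, mem_ideal_span_monomial_image]
  exact forall₂_congr fun b _ => ⟨fun ⟨c, hc, hcb⟩ => hU hcb hc, fun hb => ⟨b, hb, le_rfl⟩⟩

lemma mem_monIdeal' {U : Set (V →₀ ℕ)} (hU : IsUpperSet U) {f : MvPolynomial V k} :
    f ∈ monIdeal k U ↔ ∀ b ∉ U, f.coeff b = 0 := by
  rw [mem_monIdeal hU]
  exact forall_congr' fun b => by rw [mem_support_iff, not_imp_comm]

lemma monomial_mem_monIdeal {U : Set (V →₀ ℕ)} {b : V →₀ ℕ} (hb : b ∈ U) (a : k) :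
    monomial b a ∈ monIdeal k U := by
  have h := (monIdeal k U).mul_mem_left (C a) (Ideal.subset_span ⟨b, hb, rfl⟩)
  simpa [C_mul_monomial] using h

lemma monIdeal_mul (U U' : Set (V →₀ ℕ)) :
    monIdeal k U * monIdeal k U' = monIdeal k (Set.image2 (· + ·) U U') := by
  rw [monIdeal, monIdeal, monIdeal, Ideal.span_mul_span']
  congr 1
  ext f
  simp only [Set.mem_mul, Set.mem_image, Set.mem_image2]
  constructor
  · rintro ⟨_, ⟨b, hb, rfl⟩, _, ⟨c, hc, rfl⟩, rfl⟩
    exact ⟨_, ⟨b, hb, c, hc, rfl⟩, by simp [monomial_mul]⟩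
  · rintro ⟨_, ⟨b, hb, c, hc, rfl⟩, rfl⟩
    exact ⟨_, ⟨b, hb, rfl⟩, _, ⟨c, hc, rfl⟩, by simp [monomial_mul]⟩

lemma monIdeal_univ : monIdeal k (Set.univ : Set (V →₀ ℕ)) = ⊤ :=
  (Ideal.eq_top_iff_one _).2 (monomial_mem_monIdeal (Set.mem_univ 0) 1)

/-- Multiplication by a monomial gives a short exact sequence
`0 → S/(I : xᶜ) → S/I → S/(I + xᶜ) → 0`. -/
lemma exists_isSES_monomial {U₁ U U₂ : Set (V →₀ ℕ)} (hU : IsUpperSet U) (c : V →₀ ℕ)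
    (h₁ : ∀ b, b ∈ U₁ ↔ b + c ∈ U) (h₂ : ∀ b, b ∈ U₂ ↔ b ∈ U ∨ c ≤ b) :
    ∃ (f : MonQuot k U₁ →ₗ[MvPolynomial V k] MonQuot k U)
      (g : MonQuot k U →ₗ[MvPolynomial V k] MonQuot k U₂), IsSES f g ∧
      ∀ s, f (Ideal.Quotient.mk _ s) = Ideal.Quotient.mk _ (monomial c 1 * s) := by
  have hU₁ : IsUpperSet U₁ := fun a b hab ha =>
    (h₁ b).2 (hU (add_le_add_left hab c) ((h₁ a).1 ha))
  have hU₂ : IsUpperSet U₂ := fun a b hab ha =>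
    (h₂ b).2 (((h₂ a).1 ha).imp (hU hab) fun h => h.trans hab)
  have key : ∀ s : MvPolynomial V k, monomial c 1 * s ∈ monIdeal k U ↔ s ∈ monIdeal k U₁ := by
    intro s
    rw [mem_monIdeal' hU, mem_monIdeal' hU₁]
    constructor
    · intro h b hb
      have := h (b + c) (fun h' => hb ((h₁ b).2 h'))
      rwa [add_comm, coeff_monomial_mul, one_mul] at this
    · intro h b hb
      rw [coeff_monomial_mul']
      split_ifs with hcb
      · rw [one_mul]
        exact h _ fun h' => hb (by rw [h₁, tsub_add_cancel_of_le hcb] at h'; exact h')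
      · rfl
  have hle : monIdeal k U ≤ monIdeal k U₂ := fun s hs =>
    (mem_monIdeal hU₂).2 fun b hb => (h₂ b).2 (Or.inl ((mem_monIdeal hU).1 hs b hb))
  let m : MvPolynomial V k →ₗ[MvPolynomial V k] MvPolynomial V k :=
    LinearMap.mulLeft _ (monomial c (1 : k))
  let f : MonQuot k U₁ →ₗ[MvPolynomial V k] MonQuot k U :=
    Submodule.mapQ _ _ m fun s hs => (key s).2 hs
  let g : MonQuot k U →ₗ[MvPolynomial V k] MonQuot k U₂ :=
    Submodule.mapQ _ _ LinearMap.id hle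
  have hf : ∀ s, f (Ideal.Quotient.mk _ s) = Ideal.Quotient.mk _ (monomial c 1 * s) :=
    fun s => rfl
  have hg : ∀ s, g (Ideal.Quotient.mk _ s) = Ideal.Quotient.mk _ s := fun s => rfl
  refine ⟨f, g, ⟨?_, ?_, ?_⟩, hf⟩
  · rw [injective_iff_map_eq_zero]
    intro x hx
    obtain ⟨s, rfl⟩ := Ideal.Quotient.mk_surjective x
    rw [hf, Ideal.Quotient.eq_zero_iff_mem, key] at hx
    exact Ideal.Quotient.eq_zero_iff_mem.2 hx
  · intro x
    obtain ⟨s, rfl⟩ := Ideal.Quotient.mk_surjective x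
    rw [hg, Ideal.Quotient.eq_zero_iff_mem]
    constructor
    · intro hs
      refine ⟨Ideal.Quotient.mk _ (s.divMonomial c), ?_⟩
      rw [hf, Ideal.Quotient.eq, mem_monIdeal' hU]
      intro b hb
      rw [coeff_sub, coeff_monomial_mul']
      split_ifs with hcb
      · rw [coeff_divMonomial, add_tsub_cancel_of_le hcb, one_mul, sub_self]
      · rw [zero_sub, neg_eq_zero]
        exact (mem_monIdeal' hU₂).1 hs b fun h => ((h₂ b).1 h).elim hb hcb
    · rintro ⟨y, hy⟩
      obtain ⟨t, rfl⟩ := Ideal.Quotient.mk_surjective y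
      rw [hf, Ideal.Quotient.eq] at hy
      have h1 : monomial c 1 * t ∈ monIdeal k U₂ :=
        Ideal.mul_mem_right _ _ (monomial_mem_monIdeal ((h₂ c).2 (Or.inr le_rfl)) 1)
      simpa using sub_mem h1 (hle hy)
  · intro x
    obtain ⟨s, rfl⟩ := Ideal.Quotient.mk_surjective x
    exact ⟨Ideal.Quotient.mk _ s, hg s⟩

/-- Exponents with total degree at least `ℓ` in the variables from `A`. -/
def degGE (A : Finset V) (ℓ : ℕ) : Set (V →₀ ℕ) := {b | ℓ ≤ ∑ i ∈ A, b i}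

lemma isUpperSet_degGE (A : Finset V) (ℓ : ℕ) : IsUpperSet (degGE A ℓ) :=
  fun _ _ hab ha => le_trans ha (Finset.sum_le_sum fun i _ => hab i)

lemma mem_degGE_one {A : Finset V} {b : V →₀ ℕ} : b ∈ degGE A 1 ↔ ∃ i ∈ A, 0 < b i := by
  simp [degGE, Nat.one_le_iff_ne_zero, Finset.sum_eq_zero_iff, Nat.pos_iff_ne_zero]

lemma span_X_eq_monIdeal (A : Finset V) :
    Ideal.span (X '' (A : Set V)) = monIdeal k (degGE A 1) := by
  classical
  apply le_antisymm
  · rw [Ideal.span_le]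
    rintro _ ⟨i, hi, rfl⟩
    exact monomial_mem_monIdeal (mem_degGE_one.2 ⟨i, hi, by simp⟩) 1
  · rw [monIdeal, Ideal.span_le]
    rintro _ ⟨b, hb, rfl⟩
    obtain ⟨i, hi, hbi⟩ := mem_degGE_one.1 hb
    have : monomial b (1 : k) = monomial (b - Finsupp.single i 1) 1 * X i := by
      rw [X, monomial_mul, tsub_add_cancel_of_le (Finsupp.single_le_iff.2 hbi), one_mul]
    simp only [this]
    exact Ideal.mul_mem_left _ _ (Ideal.subset_span ⟨i, hi, rfl⟩)

lemma monIdeal_degGE_pow (A : Finset V) (ℓ : ℕ) :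
    monIdeal k (degGE A 1) ^ ℓ = monIdeal k (degGE A ℓ) := by
  classical
  induction ℓ with
  | zero =>
    rw [pow_zero, Ideal.one_eq_top, ← monIdeal_univ]
    congr 1
    ext b
    simp [degGE]
  | succ ℓ ih =>
    rw [pow_succ, ih, monIdeal_mul]
    congr 1
    ext b
    rw [Set.mem_image2]
    constructor
    · rintro ⟨u, hu, v, hv, rfl⟩
      simp only [degGE, Set.mem_ofPred_eq, Finsupp.add_apply, Finset.sum_add_distrib] at *
      lia
    · intro hb
      obtain ⟨i, hi, hbi⟩ := mem_degGE_one.1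
        (show b ∈ degGE A 1 from le_trans (Nat.le_add_left 1 ℓ) hb)
      have hs : Finsupp.single i 1 ≤ b := Finsupp.single_le_iff.2 hbi
      refine ⟨b - Finsupp.single i 1, ?_, Finsupp.single i 1, mem_degGE_one.2 ⟨i, hi, by simp⟩,
        tsub_add_cancel_of_le hs⟩
      have h1 : ∑ j ∈ A, (b - Finsupp.single i 1 : V →₀ ℕ) j + ∑ j ∈ A, (Finsupp.single i 1 : V →₀ ℕ) j
          = ∑ j ∈ A, b j := by
        rw [← Finset.sum_add_distrib]
        exact Finset.sum_congr rfl fun j _ => DFunLike.congr_fun (tsub_add_cancel_of_le hs) j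
      have h2 : ∑ j ∈ A, (Finsupp.single i 1 : V →₀ ℕ) j = 1 := by
        simp [Finsupp.single_apply, hi]
      simp only [degGE, Set.mem_ofPred_eq] at *
      lia

end MonomialIdeals

section ExtMultiplication

variable {R : Type} [CommRing R] {A B C T : Type} [AddCommGroup A] [Module R A]
  [AddCommGroup B] [Module R B] [AddCommGroup C] [Module R C] [AddCommGroup T] [Module R T]

lemma smul_ext_eq_zero_left {r : R} (hr : ∀ t : T, r • t = 0) {i : ℕ} (x : ModExt R T B i) :
    r • x = 0 := by
  have h : r • 𝟙 (ModuleCat.of R T) = 0 := by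
    ext t
    exact hr t
  rw [← Abelian.Ext.mk₀_id_comp x, ← Abelian.Ext.smul_comp, ← Abelian.Ext.mk₀_smul, h,
    Abelian.Ext.mk₀_zero, Abelian.Ext.zero_comp]

lemma smul_ext_eq_zero_right {r : R} (hr : ∀ t : T, r • t = 0) {i : ℕ} (x : ModExt R B T i) :
    r • x = 0 := by
  have h : r • 𝟙 (ModuleCat.of R T) = 0 := by
    ext t
    exact hr t
  rw [Abelian.Ext.smul_eq_comp_mk₀, h, Abelian.Ext.mk₀_zero, Abelian.Ext.comp_zero]

lemma comp_mk₀_eq_smul {r : R} {f : A →ₗ[R] A} (hf : ∀ a, f a = r • a) {i : ℕ}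
    (x : ModExt R T A i) :
    x.comp (Abelian.Ext.mk₀ (ModuleCat.ofHom f)) (add_zero i) = r • x := by
  have h : ModuleCat.ofHom f = r • 𝟙 (ModuleCat.of R A) := by
    ext t
    exact hf t
  rw [Abelian.Ext.smul_eq_comp_mk₀, h]

lemma mk₀_comp_eq_smul {r : R} {f : A →ₗ[R] A} (hf : ∀ a, f a = r • a) {i : ℕ}
    (x : ModExt R A T i) :
    (Abelian.Ext.mk₀ (ModuleCat.ofHom f)).comp x (zero_add i) = r • x := by
  have h : ModuleCat.ofHom f = r • 𝟙 (ModuleCat.of R A) := by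
    ext t
    exact hf t
  rw [h, Abelian.Ext.mk₀_smul, Abelian.Ext.smul_comp, Abelian.Ext.mk₀_id_comp]

lemma modExt_zero_nontrivial {f : A →ₗ[R] B} (hf : f ≠ 0) : Nontrivial (ModExt R A B 0) := by
  have : Nontrivial (ModuleCat.of R A ⟶ ModuleCat.of R B) :=
    ⟨ModuleCat.ofHom f, 0, fun h => hf (congrArg ModuleCat.Hom.hom h)⟩
  exact Abelian.Ext.addEquiv₀.toEquiv.nontrivial

lemma exists_modExt_zero_generator (φ : A ≃ₗ[R] R) : ∃ e : ModExt R A R 0,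
    (∀ y, ∃ s : R, y = s • e) ∧ ∀ s : R, s • e = 0 ↔ s = 0 := by
  refine ⟨Abelian.Ext.mk₀ (ModuleCat.ofHom φ.toLinearMap), fun y => ?_, fun s => ?_⟩
  · obtain ⟨y, rfl⟩ := Abelian.Ext.addEquiv₀.symm.surjective y
    refine ⟨y.hom (φ.symm 1), ?_⟩
    rw [← Abelian.Ext.mk₀_smul]
    refine congrArg Abelian.Ext.mk₀ ?_
    refine ModuleCat.hom_ext (LinearMap.ext fun x => ?_)
    change y.hom x = y.hom (φ.symm 1) * φ x
    rw [mul_comm, ← smul_eq_mul, ← map_smul, ← map_smul, smul_eq_mul, mul_one,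
      φ.symm_apply_apply]
  · rw [← Abelian.Ext.mk₀_smul, Abelian.Ext.mk₀_eq_zero_iff]
    constructor
    · intro h
      have h1 : s * φ (φ.symm 1) = 0 := LinearMap.congr_fun (congrArg ModuleCat.Hom.hom h) _
      rwa [φ.apply_symm_apply, mul_one] at h1
    · rintro rfl
      exact zero_smul _ _

variable {f : A →ₗ[R] A} {g : A →ₗ[R] C} {r : R}

lemma IsSES.ext_succ_of_smul (h : IsSES f g) (hf : ∀ a, f a = r • a) (hr : ∀ t : T, r • t = 0)
    {i : ℕ} (hC : Subsingleton (ModExt R T C i)) : Subsingleton (ModExt R T A (i + 1)) := by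
  refine subsingleton_of_forall_eq_zero fun x => ?_
  obtain ⟨y, rfl⟩ := Abelian.Ext.covariant_sequence_exact₁ _ h.shortExact x
    ((comp_mk₀_eq_smul hf x).trans (smul_ext_eq_zero_left hr x)) rfl
  rw [Subsingleton.elim y 0, Abelian.Ext.zero_comp]

lemma IsSES.ext_zero_of_smul (h : IsSES f g) (hf : ∀ a, f a = r • a) (hr : ∀ t : T, r • t = 0) :
    Subsingleton (ModExt R T A 0) := by
  have := h.shortExact.mono_f
  refine subsingleton_of_forall_eq_zero fun x => ?_
  refine (Abelian.Ext.postcomp_mk₀_injective_of_mono _ h.shortComplex.f) ?_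
  exact ((comp_mk₀_eq_smul hf x).trans (smul_ext_eq_zero_left hr x)).trans
    (map_zero _).symm

lemma IsSES.ext_of_smul' (h : IsSES f g) (hf : ∀ a, f a = r • a) (hr : ∀ t : T, r • t = 0)
    {i : ℕ} (hC : Subsingleton (ModExt R C T (i + 1))) : Subsingleton (ModExt R A T i) := by
  refine subsingleton_of_forall_eq_zero fun x => ?_
  obtain ⟨y, rfl⟩ := Abelian.Ext.contravariant_sequence_exact₁ h.shortExact _ x (add_comm 1 i)
    (Subsingleton.elim _ _)
  exact (mk₀_comp_eq_smul hf y).trans (smul_ext_eq_zero_right hr y)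

lemma IsSES.exists_generator (h : IsSES f g) (hf : ∀ a, f a = r • a) {i : ℕ}
    (hA : Subsingleton (ModExt R A T (i + 1))) {I : Ideal R}
    (hI : ∃ e : ModExt R A T i, (∀ y, ∃ s : R, y = s • e) ∧ ∀ s : R, s • e = 0 ↔ s ∈ I) :
    ∃ e : ModExt R C T (i + 1), (∀ y, ∃ s : R, y = s • e) ∧
      ∀ s : R, s • e = 0 ↔ s ∈ I ⊔ Ideal.span {r} := by
  obtain ⟨e, he, hs⟩ := hI
  refine ⟨h.shortExact.extClass.comp e (add_comm 1 i), ?_, ?_⟩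
  · intro y
    obtain ⟨x, rfl⟩ := Abelian.Ext.contravariant_sequence_exact₃ h.shortExact _ y
      (Subsingleton.elim _ _) (add_comm 1 i)
    obtain ⟨s, rfl⟩ := he x
    exact ⟨s, Abelian.Ext.comp_smul _ _ _ _⟩
  · intro s
    rw [← Abelian.Ext.comp_smul, sup_comm, Ideal.mem_span_singleton_sup]
    constructor
    · intro h0
      obtain ⟨y, hy⟩ := Abelian.Ext.contravariant_sequence_exact₁ h.shortExact _ (s • e)
        (add_comm 1 i) h0
      obtain ⟨t, rfl⟩ := he y
      rw [mk₀_comp_eq_smul hf] at hy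
      refine ⟨t, s - t * r, (hs _).1 ?_, by ring⟩
      rw [sub_smul, ← hy, smul_smul, mul_comm, sub_self]
    · rintro ⟨t, b, hb, rfl⟩
      rw [add_smul, (hs b).2 hb, add_zero, mul_comm, mul_smul, ← mk₀_comp_eq_smul hf]
      exact h.shortExact.extClass_comp_assoc _

end ExtMultiplication

section FaceRings

variable (k : Type) [Field k]

/-- The polynomial ring modulo the variables from `A`. -/
abbrev FaceRing {V : Type} (A : Finset V) : Type := MonQuot k (degGE A 1)

lemma X_smul_faceRing {V : Type} {A : Finset V} {i : V} (hi : i ∈ A) (t : FaceRing k A) :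
    (X i : MvPolynomial V k) • t = 0 := by
  obtain ⟨s, rfl⟩ := Ideal.Quotient.mk_surjective t
  refine Ideal.Quotient.eq_zero_iff_mem.2 (Ideal.mul_mem_right _ _ ?_)
  exact monomial_mem_monIdeal (mem_degGE_one.2 ⟨i, hi, by simp⟩) 1

lemma exists_isSES_faceRing {V : Type} [DecidableEq V] {A : Finset V} {j : V} (hj : j ∉ A) :
    ∃ (f : FaceRing k A →ₗ[MvPolynomial V k] FaceRing k A)
      (g : FaceRing k A →ₗ[MvPolynomial V k] FaceRing k (insert j A)), IsSES f g ∧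
      ∀ a, f a = (X j : MvPolynomial V k) • a := by
  obtain ⟨f, g, h, hf⟩ := exists_isSES_monomial (k := k) (U₁ := degGE A 1) (U := degGE A 1)
    (U₂ := degGE (insert j A) 1) (isUpperSet_degGE A 1) (Finsupp.single j 1)
    (fun b => by
      simp only [mem_degGE_one, Finsupp.add_apply]
      refine exists_congr fun i => and_congr_right fun hi => ?_
      have hij : i ≠ j := by
        rintro rfl
        exact hj hi
      rw [Finsupp.single_eq_of_ne hij, add_zero])
    (fun b => by
      rw [Finsupp.single_le_iff]
      simp only [mem_degGE_one, Finset.exists_mem_insert]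
      exact or_comm)
  refine ⟨f, g, h, fun a => ?_⟩
  obtain ⟨s, rfl⟩ := Ideal.Quotient.mk_surjective a
  exact hf s

lemma mem_monIdeal_degGE_empty {V : Type} {s : MvPolynomial V k} :
    s ∈ monIdeal k (degGE ∅ 1) ↔ s = 0 := by
  rw [mem_monIdeal (isUpperSet_degGE _ _), ← support_eq_empty, Finset.eq_empty_iff_forall_notMem]
  simp [degGE]

/-- The face ring without relations is the polynomial ring. -/
noncomputable def faceRingEmptyEquiv (V : Type) :
    MvPolynomial V k ≃ₗ[MvPolynomial V k] FaceRing k (∅ : Finset V) :=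
  LinearEquiv.ofBijective (Submodule.mkQ _) ⟨by
    rw [injective_iff_map_eq_zero]
    intro s hs
    exact (mem_monIdeal_degGE_empty k).1 ((Submodule.Quotient.mk_eq_zero _).1 hs),
    Submodule.mkQ_surjective _⟩

variable {n : ℕ}

lemma nontrivial_residue : Nontrivial (FaceRing k (Finset.univ : Finset (Fin n))) := by
  refine Ideal.Quotient.nontrivial_iff.2 fun h => ?_
  have h1 := (mem_monIdeal (isUpperSet_degGE _ 1)).1 ((Ideal.eq_top_iff_one _).1 h) 0 (by simp)
  simp [degGE] at h1

lemma faceRing_ext_zero_nontrivial :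
    Nontrivial (ModExt (MvPolynomial (Fin n) k) (FaceRing k (Finset.univ : Finset (Fin n)))
      (FaceRing k (Finset.univ : Finset (Fin n))) 0) := by
  have := nontrivial_residue k (n := n)
  exact modExt_zero_nontrivial (f := LinearMap.id) fun h =>
    one_ne_zero (LinearMap.congr_fun h (Ideal.Quotient.mk _ 1))

/-- The depth of a polynomial ring in finitely many of the variables. -/
lemma faceRing_depth (m : ℕ) (A : Finset (Fin n)) (hA : A.card + m = n) :
    (∀ i < m, Subsingleton (ModExt (MvPolynomial (Fin n) k)
      (FaceRing k (Finset.univ : Finset (Fin n))) (FaceRing k A) i)) ∧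
    Nontrivial (ModExt (MvPolynomial (Fin n) k)
      (FaceRing k (Finset.univ : Finset (Fin n))) (FaceRing k A) m) := by
  induction m generalizing A with
  | zero =>
    obtain rfl : A = Finset.univ := (Finset.card_eq_iff_eq_univ A).1 (by simpa using hA)
    exact ⟨by simp, faceRing_ext_zero_nontrivial k⟩
  | succ m ih =>
    obtain ⟨j, hj⟩ : ∃ j, j ∉ A := by
      by_contra! h
      have := Finset.card_eq_iff_eq_univ A |>.2 (Finset.eq_univ_of_forall h)
      simp at this
      lia
    obtain ⟨f, g, h, hf⟩ := exists_isSES_faceRing k hj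
    have hr := X_smul_faceRing k (Finset.mem_univ j)
    obtain ⟨h1, h2⟩ := ih (insert j A) (by rw [Finset.card_insert_of_notMem hj]; lia)
    have h3 : ∀ i < m + 1, Subsingleton (ModExt (MvPolynomial (Fin n) k)
        (FaceRing k (Finset.univ : Finset (Fin n))) (FaceRing k A) i) := by
      rintro (_ | i) hi
      · exact h.ext_zero_of_smul hf hr
      · exact h.ext_succ_of_smul hf hr (h1 i (by lia))
    refine ⟨h3, ?_⟩
    by_contra hn
    rw [not_nontrivial_iff_subsingleton] at hn
    exact not_subsingleton_iff_nontrivial.2 h2 (h.ext_right (h3 m (by lia)) hn)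

/-- The top self-extension of the residue field does not vanish. -/
lemma residue_ext_nontrivial (A : Finset (Fin n)) :
    Nontrivial (ModExt (MvPolynomial (Fin n) k) (FaceRing k A)
      (FaceRing k (Finset.univ : Finset (Fin n))) A.card) := by
  induction A using Finset.induction_on with
  | empty =>
    have := nontrivial_residue k (n := n)
    refine modExt_zero_nontrivial (f := Submodule.mapQ _ _ LinearMap.id fun s hs => ?_) fun h => ?_
    · rw [(mem_monIdeal_degGE_empty k).1 hs]
      exact zero_mem _
    · exact one_ne_zero (LinearMap.congr_fun h (Ideal.Quotient.mk _ 1))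
  | insert j A hj ih =>
    obtain ⟨f, g, h, hf⟩ := exists_isSES_faceRing k hj
    by_contra hn
    rw [not_nontrivial_iff_subsingleton, Finset.card_insert_of_notMem hj] at hn
    exact not_subsingleton_iff_nontrivial.2 ih
      (h.ext_of_smul' hf (X_smul_faceRing k (Finset.mem_univ j)) hn)

lemma faceRing_ext_self_subsingleton (A : Finset (Fin n)) {i : ℕ} (hi : A.card < i) :
    Subsingleton (ModExt (MvPolynomial (Fin n) k) (FaceRing k A) (MvPolynomial (Fin n) k) i) := by
  induction A using Finset.induction_on generalizing i with
  | empty =>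
    have h1 := Module.Projective.of_equiv (faceRingEmptyEquiv k (Fin n))
    rw [IsProjective.iff_projective] at h1
    rw [Finset.card_empty] at hi
    exact HasProjectiveDimensionLT.subsingleton _ 1 i hi _
  | insert j A hj ih =>
    obtain ⟨f, g, h, hf⟩ := exists_isSES_faceRing k hj
    rw [Finset.card_insert_of_notMem hj] at hi
    obtain ⟨i, rfl⟩ : ∃ i', i = i' + 1 := ⟨i - 1, by lia⟩
    exact h.ext_right_succ' (ih (by lia)) (ih (by lia))

lemma faceRing_exists_generator (A : Finset (Fin n)) :
    ∃ e : ModExt (MvPolynomial (Fin n) k) (FaceRing k A) (MvPolynomial (Fin n) k) A.card,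
      (∀ y, ∃ s : MvPolynomial (Fin n) k, y = s • e) ∧
      ∀ s : MvPolynomial (Fin n) k, s • e = 0 ↔ s ∈ monIdeal k (degGE A 1) := by
  induction A using Finset.induction_on with
  | empty =>
    rw [Finset.card_empty]
    simpa only [mem_monIdeal_degGE_empty] using
      exists_modExt_zero_generator (faceRingEmptyEquiv k (Fin n)).symm
  | insert j A hj ih =>
    obtain ⟨f, g, h, hf⟩ := exists_isSES_faceRing k hj
    have := h.exists_generator hf (faceRing_ext_self_subsingleton k A (Nat.lt_succ_self _)) ih
    rw [Finset.card_insert_of_notMem hj]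
    have hI : monIdeal k (degGE A 1) ⊔ Ideal.span {X j} = monIdeal k (degGE (insert j A) 1) := by
      rw [← span_X_eq_monIdeal, ← span_X_eq_monIdeal, Finset.coe_insert, Set.image_insert_eq,
        Set.insert_eq, Ideal.span_union, sup_comm]
    simpa only [hI] using this

end FaceRings

section ExtClosed

variable {R : Type} [CommRing R]

/-- A property of modules that holds for zero modules and is closed under extensions. -/
structure ExtClosed (Q : ∀ (M : Type) [AddCommGroup M] [Module R M], Prop) : Prop where
  of_subsingleton : ∀ (M : Type) [AddCommGroup M] [Module R M], Subsingleton M → Q M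
  middle : ∀ {A B C : Type} [AddCommGroup A] [Module R A] [AddCommGroup B] [Module R B]
    [AddCommGroup C] [Module R C] {f : A →ₗ[R] B} {g : B →ₗ[R] C}, IsSES f g → Q A → Q C → Q B

lemma extClosed_covariant (T : Type) [AddCommGroup T] [Module R T] (i : ℕ) :
    ExtClosed (R := R) fun M _ _ => Subsingleton (ModExt R T M i) where
  of_subsingleton M _ _ _ := subsingleton_of_forall_eq_zero fun x => by
    rw [← one_smul R x]
    exact smul_ext_eq_zero_right (fun _ => Subsingleton.elim _ _) x
  middle h hA hC := h.ext_middle hA hC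

lemma extClosed_contravariant (T : Type) [AddCommGroup T] [Module R T] (i : ℕ) :
    ExtClosed (R := R) fun M _ _ => Subsingleton (ModExt R M T i) where
  of_subsingleton M _ _ _ := subsingleton_of_forall_eq_zero fun x => by
    rw [← one_smul R x]
    exact smul_ext_eq_zero_left (fun _ => Subsingleton.elim _ _) x
  middle h hA hC := h.ext_middle' hA hC

variable {Q : ∀ (M : Type) [AddCommGroup M] [Module R M], Prop}

lemma ExtClosed.of_equiv (hQ : ExtClosed Q) {M N : Type} [AddCommGroup M] [Module R M]
    [AddCommGroup N] [Module R N] (e : M ≃ₗ[R] N) (hM : Q M) : Q N :=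
  hQ.middle (f := e.toLinearMap) (g := (0 : N →ₗ[R] PUnit))
    ⟨e.injective, fun x => by simp, fun _ => ⟨0, rfl⟩⟩ hM
    (hQ.of_subsingleton _ inferInstance)

lemma ExtClosed.pi (hQ : ExtClosed Q) (ι : Type) [Finite ι] :
    ∀ (M : ι → Type) [∀ i, AddCommGroup (M i)] [∀ i, Module R (M i)],
      (∀ i, Q (M i)) → Q (∀ i, M i) := by
  induction ι using Finite.induction_empty_option with
  | of_equiv e ih =>
    intro M _ _ hM
    exact hQ.of_equiv (LinearEquiv.piCongrLeft R M e) (ih _ fun i => hM _)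
  | h_empty =>
    intro M _ _ _
    exact hQ.of_subsingleton _ inferInstance
  | h_option ih =>
    intro M _ _ hM
    refine hQ.of_equiv (LinearEquiv.piOptionEquivProd R).symm ?_
    refine hQ.middle (f := LinearMap.inl R _ _) (g := LinearMap.snd R _ _)
      ⟨LinearMap.inl_injective, ?_, LinearMap.snd_surjective⟩ (hM none) (ih _ fun i => hM _)
    rw [LinearMap.exact_iff]
    exact (LinearMap.range_inl R _ _).symm

end ExtClosed

section Filtration

variable {k : Type} [Field k] {V : Type} [DecidableEq V]
  {Q : ∀ (M : Type) [AddCommGroup M] [Module (MvPolynomial V k) M], Prop}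

/-- A quotient by a monomial ideal `I` which is primary to the ideal of the variables from `A` has
a filtration by copies of the face ring of `A`. -/
lemma ExtClosed.monQuot_of_finite (hQ : ExtClosed Q) {A : Finset V} (hA : Q (FaceRing k A))
    (D : Finset (V →₀ ℕ)) : ∀ {U : Set (V →₀ ℕ)}, IsUpperSet U →
      (∀ b ∈ D, b.support ⊆ A) → (∀ b, b ∈ U ↔ b.filter (· ∈ A) ∉ D) → Q (MonQuot k U) := by
  induction D using Finset.strongInduction with
  | H D ih =>
    intro U hU hD hUD
    rcases D.eq_empty_or_nonempty with rfl | hne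
    · obtain rfl : U = Set.univ := Set.eq_univ_of_forall fun b => (hUD b).2 (by simp)
      refine hQ.of_subsingleton _ ?_
      exact Ideal.Quotient.subsingleton_iff.2 monIdeal_univ
    · obtain ⟨c, hc⟩ := D.exists_maximal hne
      have hcA : c.filter (· ∈ A) = c := Finsupp.filter_eq_self_iff _ _ |>.2 fun i hi =>
        hD c hc.1 (Finsupp.mem_support_iff.2 hi)
      have hcD : ∀ b, c ≤ b → (b.filter (· ∈ A) ∈ D ↔ b.filter (· ∈ A) = c) := fun b hb => by
        have h1 : c ≤ b.filter (· ∈ A) := by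
          intro i
          by_cases hi : i ∈ A
          · simpa [Finsupp.filter_apply, hi] using hb i
          · rw [← hcA]
            simp [hi]
        exact ⟨fun h => le_antisymm (hc.2 h h1) h1, fun h => h ▸ hc.1⟩
      have h₂ : ∀ b, b ∈ {b : V →₀ ℕ | b.filter (· ∈ A) ∉ D.erase c} ↔ b ∈ U ∨ c ≤ b := by
        intro b
        rw [hUD, Set.mem_ofPred_eq, Finset.mem_erase]
        constructor
        · intro h1
          by_cases h2 : b.filter (· ∈ A) = c
          · right
            rw [← h2]
            intro i
            rw [Finsupp.filter_apply]
            split_ifs <;> simp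
          · exact Or.inl fun h3 => h1 ⟨h2, h3⟩
        · rintro (h1 | h1) ⟨h2, h3⟩
          · exact h1 h3
          · exact h2 ((hcD b h1).1 h3)
      obtain ⟨f, g, h, -⟩ := exists_isSES_monomial (k := k) (U₁ := degGE A 1) (U := U)
        (U₂ := {b | b.filter (· ∈ A) ∉ D.erase c}) hU c
        (fun b => by
          rw [hUD, hcD _ le_add_self, Finsupp.filter_add, hcA, add_eq_right, mem_degGE_one,
            Finsupp.filter_eq_zero_iff]
          push Not
          simp only [Nat.pos_iff_ne_zero]) h₂
      refine hQ.middle h hA (ih _ (Finset.erase_ssubset hc.1) (fun a b hab ha =>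
          (h₂ b).2 (((h₂ a).1 ha).imp (hU hab) fun h => h.trans hab))
        (fun b hb => hD b (Finset.mem_of_mem_erase hb)) fun b => Iff.rfl)

/-- The quotient by a sum of powers of ideals generated by variables. -/
lemma ExtClosed.monQuot_of_bounded [Finite V] (hQ : ExtClosed Q) {A : Finset V} (hA : Q (FaceRing k A))
    {U : Set (V →₀ ℕ)} (hU : IsUpperSet U) (hUA : ∀ b, b ∈ U ↔ b.filter (· ∈ A) ∈ U)
    (N : ℕ) (hN : ∀ b ∉ U, ∀ i ∈ A, b i ≤ N) : Q (MonQuot k U) := by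
  have hfin : {b : V →₀ ℕ | b.support ⊆ A ∧ b ∉ U}.Finite := by
    refine (Set.finite_Iic (Finsupp.equivFunOnFinite.symm fun _ => N)).subset ?_
    intro b hb i
    by_cases hi : i ∈ A
    · exact hN b hb.2 i hi
    · simp [Finsupp.notMem_support_iff.1 fun h => hi (hb.1 h)]
  refine hQ.monQuot_of_finite hA hfin.toFinset hU (fun b hb => (hfin.mem_toFinset.1 hb).1)
    fun b => ?_
  rw [hfin.mem_toFinset, Set.mem_ofPred_eq, not_and, not_not, hUA]
  exact ⟨fun h _ => h, fun h => h fun i hi => by simp at hi; exact hi.2⟩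

end Filtration

section StanleyReisner

variable (k : Type) [Field k] {V : Type}

lemma ker_killCompl (A : Finset V) :
    RingHom.ker (killCompl (R := k) (Subtype.val_injective (p := fun i => i ∉ A)))
      = monIdeal k (degGE A 1) := by
  classical
  ext s
  rw [RingHom.mem_ker, mem_monIdeal' (isUpperSet_degGE A 1)]
  constructor
  · intro h b hb
    simp only [mem_degGE_one, not_exists, not_and, not_lt, Nat.le_zero] at hb
    have h1 := congrArg (coeff (b.comapDomain _ Subtype.val_injective.injOn)) h
    rw [coeff_killCompl, coeff_zero, Finsupp.mapDomain_comapDomain _ Subtype.val_injective] at h1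
    · exact h1
    · intro i hi
      exact ⟨⟨i, fun h2 => Finsupp.mem_support_iff.1 hi (hb i h2)⟩, rfl⟩
  · intro h
    ext b
    rw [coeff_killCompl, coeff_zero]
    refine h _ fun h1 => ?_
    obtain ⟨i, hi, h2⟩ := mem_degGE_one.1 h1
    rw [Finsupp.mapDomain_of_notMem_range _ _ (by simpa using hi)] at h2
    exact lt_irrefl _ h2

lemma monIdeal_degGE_isPrime (A : Finset V) : (monIdeal k (degGE A 1)).IsPrime := by
  rw [← ker_killCompl]
  exact RingHom.ker_isPrime _

lemma ringKrullDim_faceRing [Fintype V] [DecidableEq V] (A : Finset V) :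
    ringKrullDim (FaceRing k A) = (Aᶜ.card : ℕ) := by
  have hs : Function.Surjective (killCompl (R := k) (Subtype.val_injective (p := fun i => i ∉ A))) :=
    fun p => ⟨rename Subtype.val p, killCompl_rename_app _ p⟩
  have e := RingHom.quotientKerEquivOfSurjective (f := (killCompl (R := k)
    (Subtype.val_injective (p := fun i => i ∉ A))).toRingHom) hs
  have h1 : ringKrullDim (FaceRing k A) = ringKrullDim (MvPolynomial {i // i ∉ A} k) :=
    (ringKrullDim_eq_of_ringEquiv (Ideal.quotEquivOfEq (ker_killCompl k A).symm)).trans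
      (ringKrullDim_eq_of_ringEquiv e)
  rw [h1, MvPolynomial.ringKrullDim_of_isNoetherianRing, ringKrullDim_eq_zero_of_field, zero_add,
    Nat.card_eq_fintype_card, Fintype.card_subtype_compl, Finset.card_compl, Fintype.card_coe]

/-- The simplicial complex generated by a family of sets. -/
def generatedComplex (Φ : Finset (Finset V)) : Set (Finset V) := {σ | ∃ H ∈ Φ, σ ⊆ H}

lemma isFacet_generatedComplex {Φ : Finset (Finset V)}
    (hΦ : ∀ H ∈ Φ, ∀ H' ∈ Φ, H ⊆ H' → H = H') (F : Finset V) :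
    IsFacet (generatedComplex Φ) F ↔ F ∈ Φ := by
  constructor
  · rintro ⟨⟨H, hH, hFH⟩, h⟩
    rwa [← h H ⟨H, hH, subset_rfl⟩ hFH]
  · intro hF
    refine ⟨⟨F, hF, subset_rfl⟩, ?_⟩
    rintro G ⟨H, hH, hGH⟩ hFG
    obtain rfl := hΦ F hF H hH (hFG.trans hGH)
    exact subset_antisymm hGH hFG

lemma monIdeal_degGE_le_iff {A B : Finset V} :
    monIdeal k (degGE A 1) ≤ monIdeal k (degGE B 1) ↔ A ⊆ B := by
  classical
  constructor
  · intro h i hi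
    have h1 := (mem_monIdeal (isUpperSet_degGE B 1)).1 (h (monomial_mem_monIdeal
      (b := Finsupp.single i 1) (mem_degGE_one.2 ⟨i, hi, by simp⟩) (1 : k)))
      (Finsupp.single i 1) (by simp)
    obtain ⟨j, hj, h2⟩ := mem_degGE_one.1 h1
    rw [Finsupp.single_apply] at h2
    split_ifs at h2 with h3
    · exact h3 ▸ hj
    · exact absurd h2 (lt_irrefl _)
  · intro h
    rw [← span_X_eq_monIdeal, ← span_X_eq_monIdeal]
    exact Ideal.span_mono (Set.image_mono h)

variable [Fintype V] [DecidableEq V]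

lemma exists_le_of_srIdeal_le {Φ : Finset (Finset V)} {p : Ideal (MvPolynomial V k)} [p.IsPrime]
    (hp : srIdeal k (generatedComplex Φ) ≤ p) : ∃ H ∈ Φ, monIdeal k (degGE Hᶜ 1) ≤ p := by
  classical
  have hσ : Finset.univ.filter (fun v : V => (X v : MvPolynomial V k) ∉ p) ∈ generatedComplex Φ := by
    by_contra h
    obtain ⟨i, hi, hip⟩ := (Ideal.IsPrime.prod_mem_iff (p := p)).1
      (hp (Ideal.subset_span ⟨_, h, rfl⟩))
    exact (Finset.mem_filter.1 hi).2 hip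
  obtain ⟨H, hH, hs⟩ := hσ
  refine ⟨H, hH, ?_⟩
  rw [← span_X_eq_monIdeal, Ideal.span_le]
  rintro _ ⟨i, hi, rfl⟩
  by_contra h
  exact Finset.mem_compl.1 hi (hs (by simpa using h))

lemma srIdeal_le {Φ : Finset (Finset V)} {H : Finset V} (hH : H ∈ Φ) :
    srIdeal k (generatedComplex Φ) ≤ monIdeal k (degGE Hᶜ 1) := by
  rw [srIdeal, Ideal.span_le]
  rintro _ ⟨F, hF, rfl⟩
  obtain ⟨i, hi, hiH⟩ := Finset.not_subset.1 fun h => hF ⟨H, hH, h⟩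
  refine Ideal.mem_of_dvd _ (Finset.dvd_prod_of_mem _ hi) ?_
  exact monomial_mem_monIdeal (mem_degGE_one.2 ⟨i, by simpa using hiH, by simp⟩) 1

lemma minimalPrimes_srIdeal {Φ : Finset (Finset V)}
    (hΦ : ∀ H ∈ Φ, ∀ H' ∈ Φ, H ⊆ H' → H = H') (p : Ideal (MvPolynomial V k)) :
    p ∈ (srIdeal k (generatedComplex Φ)).minimalPrimes ↔
      ∃ H ∈ Φ, p = monIdeal k (degGE Hᶜ 1) := by
  constructor
  · intro hp
    have := hp.1.1
    obtain ⟨H, hH, hle⟩ := exists_le_of_srIdeal_le k hp.1.2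
    exact ⟨H, hH, le_antisymm (hp.2 ⟨monIdeal_degGE_isPrime k _, srIdeal_le k hH⟩ hle) hle⟩
  · rintro ⟨H, hH, rfl⟩
    refine ⟨⟨monIdeal_degGE_isPrime k _, srIdeal_le k hH⟩, fun q hq hqp => ?_⟩
    have := hq.1
    obtain ⟨H', hH', hle⟩ := exists_le_of_srIdeal_le k hq.2
    have h1 := (monIdeal_degGE_le_iff k).1 (hle.trans hqp)
    rw [Finset.compl_subset_compl] at h1
    rwa [hΦ H hH H' hH' h1]

/-- The exponents of the monomials in the `ℓ`-th symbolic power of the Stanley–Reisner ideal of the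
complex generated by `Φ`. -/
def symbSet (Φ : Finset (Finset V)) (ℓ : ℕ) : Set (V →₀ ℕ) := {b | ∀ H ∈ Φ, b ∈ degGE Hᶜ ℓ}

lemma isUpperSet_symbSet (Φ : Finset (Finset V)) (ℓ : ℕ) : IsUpperSet (symbSet Φ ℓ) :=
  fun _ _ hab ha H hH => isUpperSet_degGE _ _ hab (ha H hH)

lemma symbPow_srIdeal {Φ : Finset (Finset V)}
    (hΦ : ∀ H ∈ Φ, ∀ H' ∈ Φ, H ⊆ H' → H = H') (ℓ : ℕ) :
    symbPow (srIdeal k (generatedComplex Φ)) ℓ = monIdeal k (symbSet Φ ℓ) := by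
  ext s
  rw [symbPow, Ideal.mem_sInf, mem_monIdeal (isUpperSet_symbSet Φ ℓ)]
  constructor
  · intro h b hb H hH
    have h1 := h (I := monIdeal k (degGE Hᶜ ℓ)) ⟨_, (minimalPrimes_srIdeal k hΦ _).2 ⟨H, hH, rfl⟩,
      (monIdeal_degGE_pow _ _).symm⟩
    exact (mem_monIdeal (isUpperSet_degGE _ _)).1 h1 b hb
  · rintro h _ ⟨p, hp, rfl⟩
    obtain ⟨H, hH, rfl⟩ := (minimalPrimes_srIdeal k hΦ _).1 hp
    rw [monIdeal_degGE_pow, mem_monIdeal (isUpperSet_degGE _ _)]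
    exact fun b hb => h b hb H hH

lemma exists_le_of_monIdeal_symbSet_le {Φ : Finset (Finset V)} {ℓ : ℕ}
    {p : Ideal (MvPolynomial V k)} [hp : p.IsPrime] (h : monIdeal k (symbSet Φ ℓ) ≤ p) :
    ∃ H ∈ Φ, monIdeal k (degGE Hᶜ 1) ≤ p := by
  have h1 : ∏ H ∈ Φ, monIdeal k (degGE Hᶜ ℓ) ≤ p := by
    refine le_trans (fun s hs => ?_) h
    rw [mem_monIdeal (isUpperSet_symbSet Φ ℓ)]
    intro b hb H hH
    exact (mem_monIdeal (isUpperSet_degGE _ _)).1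
      (Ideal.le_of_dvd (Finset.dvd_prod_of_mem _ hH) hs) b hb
  obtain ⟨H, hH, hle⟩ := (Ideal.IsPrime.prod_le hp).1 h1
  rw [← monIdeal_degGE_pow] at hle
  exact ⟨H, hH, Ideal.IsPrime.le_of_pow_le hle⟩

lemma ringKrullDim_monQuot_symbSet {Φ : Finset (Finset V)} {d ℓ : ℕ} (hℓ : 1 ≤ ℓ)
    (hΦ : Φ.Nonempty) (hd : ∀ H ∈ Φ, H.card = d) :
    ringKrullDim (MonQuot k (symbSet Φ ℓ)) = d := by
  apply le_antisymm
  · rw [ringKrullDim_quotient, Order.krullDim]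
    refine iSup_le fun p => ?_
    have := p.head.1.2
    obtain ⟨H, hH, hle⟩ := exists_le_of_monIdeal_symbSet_le k (p := p.head.1.asIdeal) p.head.2
    let q : LTSeries (PrimeSpectrum.zeroLocus
        (monIdeal k (degGE Hᶜ 1) : Set (MvPolynomial V k))) :=
      { length := p.length
        toFun := fun i => ⟨(p i).1, hle.trans (p.head_le i)⟩
        step := fun i => p.step i }
    have h1 := Order.LTSeries.length_le_krullDim q
    rw [← ringKrullDim_quotient] at h1
    rwa [ringKrullDim_faceRing, compl_compl, hd H hH] at h1
  · obtain ⟨H, hH⟩ := hΦ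
    have hle : monIdeal k (symbSet Φ ℓ) ≤ monIdeal k (degGE Hᶜ 1) := fun s hs =>
      (mem_monIdeal (isUpperSet_degGE _ _)).2 fun b hb =>
        hℓ.trans ((mem_monIdeal (isUpperSet_symbSet Φ ℓ)).1 hs b hb H hH)
    have h1 := ringKrullDim_le_of_surjective _ (Ideal.Quotient.factor_surjective hle)
    rwa [ringKrullDim_faceRing, compl_compl, hd H hH] at h1

end StanleyReisner

section Depth

variable (k : Type) [Field k] {n : ℕ}

lemma maxIdeal_eq_monIdeal :
    maxIdeal k (Fin n) = monIdeal k (degGE (Finset.univ : Finset (Fin n)) 1) := by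
  rw [maxIdeal, ← span_X_eq_monIdeal, Finset.coe_univ, Set.image_univ]

lemma nontrivial_ext_residue_iff (U : Set (Fin n →₀ ℕ)) (i : ℕ) :
    Nontrivial (extM (quotMod k (maxIdeal k (Fin n))) (quotMod k (monIdeal k U)) i) ↔
      Nontrivial (ModExt (MvPolynomial (Fin n) k) (FaceRing k (Finset.univ : Finset (Fin n)))
        (MonQuot k U) i) := by
  rw [maxIdeal_eq_monIdeal]
  obtain ⟨e⟩ := extM_linearEquiv (quotMod k (monIdeal k (degGE (Finset.univ : Finset (Fin n)) 1)))
    (quotMod k (monIdeal k U)) i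
  exact e.toEquiv.nontrivial_congr

lemma nontrivial_ext_residue_top {U : Set (Fin n →₀ ℕ)}
    (hU : U ⊆ degGE (Finset.univ : Finset (Fin n)) 1) :
    Nontrivial (ModExt (MvPolynomial (Fin n) k) (FaceRing k (Finset.univ : Finset (Fin n)))
        (MonQuot k U) n) := by
  by_contra h
  rw [not_nontrivial_iff_subsingleton] at h
  have hle : monIdeal k U ≤ monIdeal k (degGE (Finset.univ : Finset (Fin n)) 1) :=
    Ideal.span_mono (Set.image_mono hU)
  have h1 := (isSES_ker (R := MvPolynomial (Fin n) k) (g := Submodule.factor hle)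
    (Submodule.factor_surjective hle)).ext_right h
    (subsingleton_modExt_of_lt k n _ _ (Nat.lt_succ_self n))
  have h2 := residue_ext_nontrivial k (Finset.univ : Finset (Fin n))
  rw [Finset.card_univ, Fintype.card_fin] at h2
  exact not_subsingleton_iff_nontrivial.2 h2 h1

lemma mdepth_quotMod_eq {U : Set (Fin n →₀ ℕ)} {m : ℕ}
    (h : ∀ i < m, Subsingleton (ModExt (MvPolynomial (Fin n) k)
      (FaceRing k (Finset.univ : Finset (Fin n))) (MonQuot k U) i))
    (hm : Nontrivial (ModExt (MvPolynomial (Fin n) k)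
      (FaceRing k (Finset.univ : Finset (Fin n))) (MonQuot k U) m)) :
    mdepth k (quotMod k (monIdeal k U)) = m := by
  refine le_antisymm (Nat.sInf_le ((nontrivial_ext_residue_iff k U m).2 hm)) ?_
  refine le_csInf ⟨m, (nontrivial_ext_residue_iff k U m).2 hm⟩ fun i hi => ?_
  by_contra hlt
  exact not_subsingleton_iff_nontrivial.2 ((nontrivial_ext_residue_iff k U i).1 hi)
    (h i (not_le.1 hlt))

lemma le_mdepth_quotMod {U : Set (Fin n →₀ ℕ)} {m : ℕ}
    (hU : U ⊆ degGE (Finset.univ : Finset (Fin n)) 1)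
    (h : ∀ i < m, Subsingleton (ModExt (MvPolynomial (Fin n) k)
      (FaceRing k (Finset.univ : Finset (Fin n))) (MonQuot k U) i)) :
    m ≤ mdepth k (quotMod k (monIdeal k U)) := by
  refine le_csInf ⟨n, (nontrivial_ext_residue_iff k U n).2 (nontrivial_ext_residue_top k hU)⟩
    fun i hi => ?_
  by_contra hlt
  exact not_subsingleton_iff_nontrivial.2 ((nontrivial_ext_residue_iff k U i).1 hi)
    (h i (not_le.1 hlt))

lemma modDim_serreK (U : Set (Fin n →₀ ℕ)) (j : ℕ) :
    modDim (serreK k (quotMod k (monIdeal k U)) j) = ringKrullDim (MvPolynomial (Fin n) k ⧸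
      Module.annihilator (MvPolynomial (Fin n) k)
        (ModExt (MvPolynomial (Fin n) k) (MonQuot k U) (MvPolynomial (Fin n) k) (n - j))) := by
  rw [modDim, serreK, Nat.card_eq_fintype_card, Fintype.card_fin]
  obtain ⟨e⟩ := extM_linearEquiv (quotMod k (monIdeal k U))
    (ModuleCat.of _ (MvPolynomial (Fin n) k)) (n - j)
  rw [e.annihilator_eq]
  rfl

lemma modDim_serreK_of_subsingleton {U : Set (Fin n →₀ ℕ)} {j : ℕ}
    (h : Subsingleton (ModExt (MvPolynomial (Fin n) k) (MonQuot k U) (MvPolynomial (Fin n) k)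
      (n - j))) :
    modDim (serreK k (quotMod k (monIdeal k U)) j) = ⊥ := by
  rw [modDim_serreK, Module.annihilator_eq_top_iff.2 h]
  have : Subsingleton (MvPolynomial (Fin n) k ⧸ (⊤ : Ideal (MvPolynomial (Fin n) k))) :=
    Ideal.Quotient.subsingleton_iff.2 rfl
  exact ringKrullDim_eq_bot_of_subsingleton

lemma zero_le_modDim_serreK {U : Set (Fin n →₀ ℕ)} {j : ℕ}
    (h : Nontrivial (ModExt (MvPolynomial (Fin n) k) (MonQuot k U) (MvPolynomial (Fin n) k)
      (n - j))) :
    0 ≤ modDim (serreK k (quotMod k (monIdeal k U)) j) := by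
  rw [modDim_serreK]
  have : Nontrivial (MvPolynomial (Fin n) k ⧸ Module.annihilator (MvPolynomial (Fin n) k)
        (ModExt (MvPolynomial (Fin n) k) (MonQuot k U) (MvPolynomial (Fin n) k) (n - j))) := by
    rw [Ideal.Quotient.nontrivial_iff, Ne, Module.annihilator_eq_top_iff]
    exact not_subsingleton_iff_nontrivial.2 h
  exact ringKrullDim_nonneg_of_nontrivial

lemma serreDepth_two_eq_one {U : Set (Fin n →₀ ℕ)}
    (h0 : Subsingleton (ModExt (MvPolynomial (Fin n) k) (MonQuot k U) (MvPolynomial (Fin n) k) n))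
    (h1 : Nontrivial (ModExt (MvPolynomial (Fin n) k) (MonQuot k U) (MvPolynomial (Fin n) k)
      (n - 1))) :
    serreDepth k 2 (quotMod k (monIdeal k U)) = 1 := by
  have hmem : 1 ∈ {j : ℕ | ((j + 1 - 2 : ℕ) : WithBot ℕ∞) ≤
      modDim (serreK k (quotMod k (monIdeal k U)) j)} := zero_le_modDim_serreK k h1
  refine le_antisymm (Nat.sInf_le hmem) (le_csInf ⟨1, hmem⟩ fun j hj => ?_)
  by_contra hlt
  obtain rfl : j = 0 := by lia
  rw [Set.mem_ofPred_eq, modDim_serreK_of_subsingleton k h0] at hj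
  exact absurd hj (by simp)

lemma two_le_serreDepth_two {U : Set (Fin n →₀ ℕ)}
    (h0 : Subsingleton (ModExt (MvPolynomial (Fin n) k) (MonQuot k U) (MvPolynomial (Fin n) k) n))
    (h1 : Subsingleton (ModExt (MvPolynomial (Fin n) k) (MonQuot k U) (MvPolynomial (Fin n) k)
      (n - 1)))
    {m : ℕ} (hm : (m : WithBot ℕ∞) ≤ modDim (serreK k (quotMod k (monIdeal k U)) m)) :
    2 ≤ serreDepth k 2 (quotMod k (monIdeal k U)) := by
  refine le_csInf ⟨m, le_trans ?_ hm⟩ fun j hj => ?_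
  · exact_mod_cast (by lia : m + 1 - 2 ≤ m)
  · by_contra hlt
    obtain rfl | rfl : j = 0 ∨ j = 1 := by lia
    · rw [Set.mem_ofPred_eq, modDim_serreK_of_subsingleton k h0] at hj
      exact absurd hj (by simp)
    · rw [Set.mem_ofPred_eq, modDim_serreK_of_subsingleton k h1] at hj
      exact absurd hj (by simp)

/-- If the localizations of a monomial ideal and of a power of a prime ideal `P` generated by
variables at `P` agree, then `P` contains the annihilator of the corresponding `Ext`-module. -/
lemma annihilator_ext_le {U : Set (Fin n →₀ ℕ)} {A : Finset (Fin n)} {ℓ : ℕ} (hℓ : 1 ≤ ℓ)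
    (hA : A.Nonempty) (hU : IsUpperSet U) (hUA : U ⊆ degGE A ℓ) {c : Fin n →₀ ℕ} (hc : c ∉ degGE A 1)
    (hcU : ∀ b ∈ degGE A ℓ, b + c ∈ U) :
    Module.annihilator (MvPolynomial (Fin n) k) (ModExt (MvPolynomial (Fin n) k) (MonQuot k U)
      (MvPolynomial (Fin n) k) A.card) ≤ monIdeal k (degGE A 1) := by
  intro s hs
  rw [Module.mem_annihilator] at hs
  have hle : monIdeal k U ≤ monIdeal k (degGE A ℓ) := Ideal.span_mono (Set.image_mono hUA)
  have hker := isSES_ker (R := MvPolynomial (Fin n) k) (g := Submodule.factor hle)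
    (Submodule.factor_surjective hle)
  have hfker : ∀ t : LinearMap.ker (Submodule.factor hle),
      (monomial c 1 : MvPolynomial (Fin n) k) • t = 0 := by
    rintro ⟨t, ht⟩
    obtain ⟨t, rfl⟩ := Ideal.Quotient.mk_surjective t
    refine Subtype.ext (Ideal.Quotient.eq_zero_iff_mem.2 ?_)
    have ht' : t ∈ monIdeal k (degGE A ℓ) := Ideal.Quotient.eq_zero_iff_mem.1 ht
    rw [mem_monIdeal' (isUpperSet_degGE A ℓ)] at ht'
    change monomial c 1 * t ∈ monIdeal k U
    rw [mem_monIdeal' hU]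
    intro b hb
    rw [coeff_monomial_mul']
    split_ifs with hcb
    · rw [ht' _ fun h => hb ?_, mul_zero]
      rw [← tsub_add_cancel_of_le hcb]
      exact hcU _ h
    · rfl
  obtain ⟨g, hg⟩ := hA
  obtain ⟨φ, ψ, hses, -⟩ := exists_isSES_monomial (k := k) (U₁ := degGE A 1) (U := degGE A ℓ)
    (U₂ := {b | b ∈ degGE A ℓ ∨ Finsupp.single g (ℓ - 1) ≤ b}) (isUpperSet_degGE A ℓ)
    (Finsupp.single g (ℓ - 1)) (fun b => by
      have : ∑ i ∈ A, Finsupp.single g (ℓ - 1) i = ℓ - 1 := by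
        rw [Finset.sum_eq_single_of_mem g hg fun i _ hi => Finsupp.single_eq_of_ne hi,
          Finsupp.single_eq_same]
      simp only [degGE, Set.mem_ofPred_eq, Finsupp.add_apply, Finset.sum_add_distrib, this]
      lia) (fun b => Iff.rfl)
  have hQ := (extClosed_contravariant (R := MvPolynomial (Fin n) k) (MvPolynomial (Fin n) k)
    (A.card + 1)).monQuot_of_bounded
    (faceRing_ext_self_subsingleton k A (Nat.lt_succ_self _))
    (U := {b | b ∈ degGE A ℓ ∨ Finsupp.single g (ℓ - 1) ≤ b})
    (fun a b hab h => h.imp (isUpperSet_degGE A ℓ hab) fun h => h.trans hab)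
    (fun b => by
      have h1 : ∑ i ∈ A, b.filter (· ∈ A) i = ∑ i ∈ A, b i :=
        Finset.sum_congr rfl fun i hi => Finsupp.filter_apply_pos _ _ hi
      simp only [degGE, Set.mem_ofPred_eq, h1, Finsupp.single_le_iff,
        Finsupp.filter_apply_pos (· ∈ A) b hg]) ℓ
    (fun b hb i hi => by
      have h1 := Finset.single_le_sum (f := fun i => b i) (fun _ _ => Nat.zero_le _) hi
      simp only [degGE, Set.mem_ofPred_eq] at hb
      push Not at hb
      exact h1.trans hb.1.le)
  obtain ⟨e, -, he⟩ := faceRing_exists_generator k A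
  obtain ⟨x, rfl⟩ := Abelian.Ext.contravariant_sequence_exact₁ hses.shortExact _ e (add_comm 1 _)
    (Subsingleton.elim _ _)
  have hx : (monomial c 1 : MvPolynomial (Fin n) k) • s • x = 0 := by
    obtain ⟨m, hm⟩ : ∃ m, A.card = m + 1 := ⟨A.card - 1, by
      have := Finset.card_pos.2 ⟨g, hg⟩
      lia⟩
    generalize A.card = N at *
    subst hm
    obtain ⟨y, hy⟩ := Abelian.Ext.contravariant_sequence_exact₃ hker.shortExact _ (s • x) (by
      rw [Abelian.Ext.comp_smul]
      exact hs _) (add_comm 1 _)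
    rw [← hy, ← Abelian.Ext.comp_smul]
    have : (monomial c 1 : MvPolynomial (Fin n) k) • y = 0 := smul_ext_eq_zero_left hfker y
    rw [this, Abelian.Ext.comp_zero]
  have h1 := (he (monomial c 1 * s)).1 (by
    rw [mul_smul, ← Abelian.Ext.comp_smul, ← Abelian.Ext.comp_smul, hx, Abelian.Ext.comp_zero])
  have := monIdeal_degGE_isPrime k A
  refine (this.mem_or_mem h1).resolve_left fun h2 => hc ?_
  exact (mem_monIdeal (isUpperSet_degGE A 1)).1 h2 c (by simp)

lemma card_compl_le_modDim_serreK {U : Set (Fin n →₀ ℕ)} {A : Finset (Fin n)} {ℓ : ℕ} (hℓ : 1 ≤ ℓ)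
    (hA : A.Nonempty) (hU : IsUpperSet U) (hUA : U ⊆ degGE A ℓ) {c : Fin n →₀ ℕ} (hc : c ∉ degGE A 1)
    (hcU : ∀ b ∈ degGE A ℓ, b + c ∈ U) :
    ((Aᶜ.card : ℕ) : WithBot ℕ∞) ≤ modDim (serreK k (quotMod k (monIdeal k U)) Aᶜ.card) := by
  have h1 : n - Aᶜ.card = A.card := by
    have := Finset.card_add_card_compl A
    rw [Fintype.card_fin] at this
    lia
  rw [modDim_serreK, h1, ← ringKrullDim_faceRing k]
  exact ringKrullDim_le_of_surjective _
    (Ideal.Quotient.factor_surjective (annihilator_ext_le k hℓ hA hU hUA hc hcU))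

end Depth

section Diagonal

variable {k : Type} [Field k]

/-- The quotient by the sum of the `ℓ`-th powers of two primes generated by variables. -/
lemma ExtClosed.monQuot_union {V : Type} [Finite V] [DecidableEq V]
    {Q : ∀ (M : Type) [AddCommGroup M] [Module (MvPolynomial V k) M], Prop}
    (hQ : ExtClosed Q) {A B : Finset V} (h : Q (FaceRing k (A ∪ B))) (ℓ : ℕ) :
    Q (MonQuot k (degGE A ℓ ∪ degGE B ℓ)) := by
  refine hQ.monQuot_of_bounded h
    ((isUpperSet_degGE A ℓ).union (isUpperSet_degGE B ℓ)) (fun b => ?_) ℓ fun b hb i hi => ?_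
  · have hA : ∑ i ∈ A, b.filter (· ∈ A ∪ B) i = ∑ i ∈ A, b i := Finset.sum_congr rfl fun i hi =>
      Finsupp.filter_apply_pos _ _ (Finset.mem_union_left _ hi)
    have hB : ∑ i ∈ B, b.filter (· ∈ A ∪ B) i = ∑ i ∈ B, b i := Finset.sum_congr rfl fun i hi =>
      Finsupp.filter_apply_pos _ _ (Finset.mem_union_right _ hi)
    simp only [degGE, Set.mem_union, Set.mem_ofPred_eq, hA, hB]
  · simp only [degGE, Set.mem_union, Set.mem_ofPred_eq] at hb
    push Not at hb
    rcases Finset.mem_union.1 hi with hi | hi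
    · exact (Finset.single_le_sum (f := fun i => b i) (fun _ _ => Nat.zero_le _) hi).trans hb.1.le
    · exact (Finset.single_le_sum (f := fun i => b i) (fun _ _ => Nat.zero_le _) hi).trans hb.2.le

lemma ExtClosed.monQuot_degGE {V : Type} [Finite V] [DecidableEq V]
    {Q : ∀ (M : Type) [AddCommGroup M] [Module (MvPolynomial V k) M], Prop}
    (hQ : ExtClosed Q) {A : Finset V} (h : Q (FaceRing k A)) (ℓ : ℕ) :
    Q (MonQuot k (degGE A ℓ)) := by
  have := hQ.monQuot_union (A := A) (B := A) (by rwa [Finset.union_self]) ℓ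
  rwa [Set.union_self] at this

variable {V : Type} [Fintype V] [DecidableEq V] (Φ : Finset (Finset V)) (ℓ : ℕ)

/-- The product of the primary quotients over the generating faces. -/
abbrev PrimaryProd (k : Type) [Field k] (Φ : Finset (Finset V)) (ℓ : ℕ) : Type :=
  ∀ H : {H // H ∈ Φ}, MonQuot k (degGE H.1ᶜ ℓ)

lemma monIdeal_symbSet_le (H : {H // H ∈ Φ}) :
    monIdeal k (symbSet Φ ℓ) ≤ monIdeal k (degGE H.1ᶜ ℓ) :=
  Ideal.span_mono (Set.image_mono fun _ hb => hb H.1 H.2)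

variable (k) in
/-- The embedding of the quotient by the symbolic power into the product of the primary
quotients. -/
noncomputable def diag : MonQuot k (symbSet Φ ℓ) →ₗ[MvPolynomial V k] PrimaryProd k Φ ℓ :=
  LinearMap.pi fun H => Submodule.factor (monIdeal_symbSet_le Φ ℓ H)

lemma diag_mk (s : MvPolynomial V k) (H : {H // H ∈ Φ}) :
    diag k Φ ℓ (Ideal.Quotient.mk _ s) H = Ideal.Quotient.mk _ s := rfl

lemma diag_injective : Function.Injective (diag k Φ ℓ) := by
  rw [← LinearMap.ker_eq_bot, LinearMap.ker_eq_bot']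
  intro x hx
  obtain ⟨s, rfl⟩ := Ideal.Quotient.mk_surjective x
  refine Ideal.Quotient.eq_zero_iff_mem.2 ((mem_monIdeal (isUpperSet_symbSet Φ ℓ)).2 ?_)
  intro b hb H hH
  have h1 : Ideal.Quotient.mk (monIdeal k (degGE Hᶜ ℓ)) s = 0 := congrFun hx ⟨H, hH⟩
  exact (mem_monIdeal (isUpperSet_degGE _ _)).1 (Ideal.Quotient.eq_zero_iff_mem.1 h1) b hb

/-- The pairs of generating faces that intersect. -/
abbrev MeetingPairs (Φ : Finset (Finset V)) : Type :=
  {p : {H // H ∈ Φ} × {H // H ∈ Φ} // (p.1.1 ∩ p.2.1).Nonempty}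

variable (k) in
/-- The differences of the components at intersecting faces. -/
noncomputable def meetDiff : PrimaryProd k Φ ℓ →ₗ[MvPolynomial V k]
    ∀ p : MeetingPairs Φ, MonQuot k (degGE p.1.1.1ᶜ ℓ ∪ degGE p.1.2.1ᶜ ℓ) :=
  LinearMap.pi fun p =>
    Submodule.factor (Ideal.span_mono (Set.image_mono Set.subset_union_left)) ∘ₗ
      LinearMap.proj p.1.1 -
    Submodule.factor (Ideal.span_mono (Set.image_mono Set.subset_union_right)) ∘ₗ
      LinearMap.proj p.1.2

lemma meetDiff_mk (t : {H // H ∈ Φ} → MvPolynomial V k) (p : MeetingPairs Φ) :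
    meetDiff k Φ ℓ (fun H => Ideal.Quotient.mk _ (t H)) p =
      Ideal.Quotient.mk _ (t p.1.1 - t p.1.2) := rfl

/-- For every exponent, the graph of those generating faces whose prime power does not contain the
monomial is connected. -/
def MeetConnected (k : Type) (Φ : Finset (Finset V)) (ℓ : ℕ) : Prop :=
  ∀ (b : V →₀ ℕ) (φ : {H // H ∈ Φ} → k),
    (∀ H H' : {H // H ∈ Φ}, b ∉ degGE H.1ᶜ ℓ → b ∉ degGE H'.1ᶜ ℓ → (H.1 ∩ H'.1).Nonempty →
      φ H = φ H') →
    ∀ H H' : {H // H ∈ Φ}, b ∉ degGE H.1ᶜ ℓ → b ∉ degGE H'.1ᶜ ℓ → φ H = φ H'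

lemma exact_diag_meetDiff (h : MeetConnected k Φ ℓ) :
    Function.Exact (diag k Φ ℓ) (meetDiff k Φ ℓ) := by
  classical
  intro x
  constructor
  · intro hx
    choose t ht using fun H => Ideal.Quotient.mk_surjective (x H)
    obtain rfl : (fun H => Ideal.Quotient.mk _ (t H)) = x := funext ht
    have hcoeff : ∀ (b : V →₀ ℕ) (H H' : {H // H ∈ Φ}), b ∉ degGE H.1ᶜ ℓ → b ∉ degGE H'.1ᶜ ℓ →
        (t H).coeff b = (t H').coeff b := by
      intro b
      refine h b (fun H => (t H).coeff b) fun H H' hb hb' hne => ?_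
      have h1 := congrFun hx ⟨(H, H'), hne⟩
      rw [meetDiff_mk] at h1
      have h2 := (mem_monIdeal' ((isUpperSet_degGE _ _).union (isUpperSet_degGE _ _))).1
        (Ideal.Quotient.eq_zero_iff_mem.1 h1) b (fun h3 => h3.elim hb hb')
      rwa [coeff_sub, sub_eq_zero] at h2
    let D : Finset (V →₀ ℕ) := Finset.univ.biUnion fun H => (t H).support
    let v : (V →₀ ℕ) → k := fun b =>
      if hb : ∃ H : {H // H ∈ Φ}, b ∉ degGE H.1ᶜ ℓ then (t hb.choose).coeff b else 0
    refine ⟨Ideal.Quotient.mk _ (∑ b ∈ D, monomial b (v b)), funext fun H => ?_⟩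
    rw [diag_mk]
    refine Ideal.Quotient.eq.2 ((mem_monIdeal' (isUpperSet_degGE _ _)).2 fun b hb => ?_)
    rw [coeff_sub, sub_eq_zero, coeff_sum]
    simp only [coeff_monomial, Finset.sum_ite_eq']
    have hex : ∃ H : {H // H ∈ Φ}, b ∉ degGE H.1ᶜ ℓ := ⟨H, hb⟩
    split_ifs with hD
    · simp only [v, dif_pos hex]
      exact hcoeff b _ _ hex.choose_spec hb
    · simp only [D, Finset.mem_biUnion, Finset.mem_univ, true_and, not_exists] at hD
      exact (notMem_support_iff.1 (hD H)).symm
  · rintro ⟨y, rfl⟩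
    obtain ⟨s, rfl⟩ := Ideal.Quotient.mk_surjective y
    funext p
    have h1 := meetDiff_mk (k := k) Φ ℓ (fun _ => s) p
    rw [sub_self, map_zero] at h1
    exact h1

end Diagonal

section Consequences

variable {k : Type} [Field k] {n : ℕ} {Φ : Finset (Finset (Fin n))} {ℓ : ℕ}

lemma primaryProd_ext_residue (hΦ : ∀ H ∈ Φ, 2 ≤ H.card) {i : ℕ} (hi : i < 2) :
    Subsingleton (ModExt (MvPolynomial (Fin n) k) (FaceRing k (Finset.univ : Finset (Fin n)))
      (PrimaryProd k Φ ℓ) i) := by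
  refine (extClosed_covariant (R := MvPolynomial (Fin n) k) _ i).pi _ _ fun H =>
    (extClosed_covariant (R := MvPolynomial (Fin n) k) _ i).monQuot_degGE ?_ ℓ
  have h1 := Finset.card_compl_add_card H.1
  rw [Fintype.card_fin] at h1
  exact (faceRing_depth k _ _ h1).1 i (hi.trans_le (hΦ H.1 H.2))

lemma primaryProd_ext_self (hΦ : ∀ H ∈ Φ, 2 ≤ H.card) {i : ℕ} (hi : n < i + 2) :
    Subsingleton (ModExt (MvPolynomial (Fin n) k) (PrimaryProd k Φ ℓ) (MvPolynomial (Fin n) k)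
      i) := by
  refine (extClosed_contravariant (R := MvPolynomial (Fin n) k) _ i).pi _ _ fun H =>
    (extClosed_contravariant (R := MvPolynomial (Fin n) k) _ i).monQuot_degGE ?_ ℓ
  have h1 := Finset.card_compl_add_card H.1
  have h2 := hΦ H.1 H.2
  rw [Fintype.card_fin] at h1
  exact faceRing_ext_self_subsingleton k _ (by lia)

lemma meetProd_ext_residue : Subsingleton (ModExt (MvPolynomial (Fin n) k)
    (FaceRing k (Finset.univ : Finset (Fin n)))
    (∀ p : MeetingPairs Φ, MonQuot k (degGE p.1.1.1ᶜ ℓ ∪ degGE p.1.2.1ᶜ ℓ)) 0) := by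
  refine (extClosed_covariant (R := MvPolynomial (Fin n) k) _ 0).pi _ _ fun p =>
    (extClosed_covariant (R := MvPolynomial (Fin n) k) _ 0).monQuot_union ?_ ℓ
  have h1 := Finset.card_compl_add_card (p.1.1.1 ∩ p.1.2.1)
  rw [Fintype.card_fin, Finset.compl_inter] at h1
  exact (faceRing_depth k _ _ h1).1 0 (Finset.card_pos.2 p.2)

lemma meetProd_ext_self : Subsingleton (ModExt (MvPolynomial (Fin n) k)
    (∀ p : MeetingPairs Φ, MonQuot k (degGE p.1.1.1ᶜ ℓ ∪ degGE p.1.2.1ᶜ ℓ))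
    (MvPolynomial (Fin n) k) n) := by
  refine (extClosed_contravariant (R := MvPolynomial (Fin n) k) _ n).pi _ _ fun p =>
    (extClosed_contravariant (R := MvPolynomial (Fin n) k) _ n).monQuot_union ?_ ℓ
  have h1 := Finset.card_compl_add_card (p.1.1.1 ∩ p.1.2.1)
  have h2 := Finset.card_pos.2 p.2
  rw [Fintype.card_fin, Finset.compl_inter] at h1
  exact faceRing_ext_self_subsingleton k _ (by lia)

lemma isSES_rangeRestrict {R A B C : Type} [CommRing R] [AddCommGroup A] [Module R A]
    [AddCommGroup B] [Module R B] [AddCommGroup C] [Module R C] {f : A →ₗ[R] B} {g : B →ₗ[R] C}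
    (hf : Function.Injective f) (h : Function.Exact f g) : IsSES f g.rangeRestrict where
  inj := hf
  exact x := by
    rw [← h x]
    exact Subtype.ext_iff
  surj := g.surjective_rangeRestrict

/-- Connectedness forces depth at least two. -/
lemma ext_residue_of_meetConnected (hΦ : ∀ H ∈ Φ, 2 ≤ H.card) (h : MeetConnected k Φ ℓ) {i : ℕ}
    (hi : i < 2) : Subsingleton (ModExt (MvPolynomial (Fin n) k)
      (FaceRing k (Finset.univ : Finset (Fin n))) (MonQuot k (symbSet Φ ℓ)) i) := by
  have hs := isSES_rangeRestrict (diag_injective Φ ℓ) (exact_diag_meetDiff Φ ℓ h)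
  obtain rfl | rfl : i = 0 ∨ i = 1 := by lia
  · exact hs.ext_left_zero (primaryProd_ext_residue hΦ hi)
  · exact hs.ext_left_succ ((isSES_mkQ _).ext_left_zero meetProd_ext_residue)
      (primaryProd_ext_residue hΦ hi)

lemma ext_self_of_meetConnected (hΦ : ∀ H ∈ Φ, 2 ≤ H.card) (h : MeetConnected k Φ ℓ) {i : ℕ}
    (hi : n ≤ i + 1) : Subsingleton (ModExt (MvPolynomial (Fin n) k)
      (MonQuot k (symbSet Φ ℓ)) (MvPolynomial (Fin n) k) i) := by
  have hs := isSES_rangeRestrict (diag_injective Φ ℓ) (exact_diag_meetDiff Φ ℓ h)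
  refine hs.ext_left' (primaryProd_ext_self hΦ (by lia)) ?_
  rcases hi.eq_or_lt with h1 | h1
  · refine (isSES_mkQ _).ext_left' ?_ (subsingleton_modExt_of_lt k n _ _ (by lia))
    rw [← h1]
    exact meetProd_ext_self
  · exact subsingleton_modExt_of_lt k n _ _ h1

/-- The residue field embeds into any module containing a nonzero element killed by all
variables. -/
lemma exists_residue_embedding {N : Type} [AddCommGroup N] [Module (MvPolynomial (Fin n) k) N]
    {x : N} (hx : x ≠ 0) (h : ∀ i, (X i : MvPolynomial (Fin n) k) • x = 0) :
    ∃ f : FaceRing k (Finset.univ : Finset (Fin n)) →ₗ[MvPolynomial (Fin n) k] N,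
      Function.Injective f ∧ f ≠ 0 := by
  have hle : monIdeal k (degGE (Finset.univ : Finset (Fin n)) 1) ≤
      LinearMap.ker (LinearMap.toSpanSingleton (MvPolynomial (Fin n) k) N x) := by
    rw [← span_X_eq_monIdeal, Ideal.span_le]
    rintro _ ⟨i, -, rfl⟩
    exact h i
  have hf : ∀ s : MvPolynomial (Fin n) k,
      Submodule.liftQ _ _ hle (Submodule.Quotient.mk s) = s • x := fun s => rfl
  refine ⟨Submodule.liftQ _ _ hle, ?_, fun h0 => hx ?_⟩
  · rw [← LinearMap.ker_eq_bot, LinearMap.ker_eq_bot']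
    intro y hy
    obtain ⟨s, rfl⟩ := Submodule.Quotient.mk_surjective _ y
    have hs : s - C (s.coeff 0) ∈ monIdeal k (degGE (Finset.univ : Finset (Fin n)) 1) := by
      rw [mem_monIdeal' (isUpperSet_degGE _ _)]
      intro b hb
      obtain rfl : b = 0 := by
        ext i
        by_contra hi
        exact hb (mem_degGE_one.2 ⟨i, Finset.mem_univ i, Nat.pos_of_ne_zero hi⟩)
      simp
    have h1 : s • x = (C (s.coeff 0) : MvPolynomial (Fin n) k) • x := by
      rw [← sub_eq_zero, ← sub_smul]
      exact hle hs
    rw [hf, h1] at hy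
    have h2 : s.coeff 0 = 0 := by
      by_contra h2
      apply hx
      have h3 := congrArg (fun z : N => (C (s.coeff 0)⁻¹ : MvPolynomial (Fin n) k) • z) hy
      simpa only [smul_smul, ← C_mul, inv_mul_cancel₀ h2, C_1, one_smul, smul_zero] using h3
    rw [h2, C_0, sub_zero] at hs
    exact (Submodule.Quotient.mk_eq_zero _).2 hs
  · rw [← one_smul (MvPolynomial (Fin n) k) x, ← hf, h0]
    rfl

/-- An exponent at which the graph of faces is disconnected, because of an isolated face `F`, and
all of whose proper multiples see only one component. -/
lemma exists_socle_element {F G : Finset (Fin n)} (hF : F ∈ Φ) (hG : G ∈ Φ) (hFG : F ≠ G)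
    {a : Fin n →₀ ℕ} (haF : a ∉ degGE Fᶜ ℓ) (haG : a ∉ degGE Gᶜ ℓ)
    (ha : ∀ i, a + Finsupp.single i 1 ∈ degGE Fᶜ ℓ ∨
      ∀ H ∈ Φ, H ≠ F → a + Finsupp.single i 1 ∈ degGE Hᶜ ℓ) :
    ∃ x : PrimaryProd k Φ ℓ ⧸ LinearMap.range (diag k Φ ℓ), x ≠ 0 ∧
      ∀ i, (X i : MvPolynomial (Fin n) k) • x = 0 := by
  classical
  have hX : ∀ i, (X i : MvPolynomial (Fin n) k) * monomial a 1 =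
      monomial (a + Finsupp.single i 1) 1 := fun i => by
    rw [X, monomial_mul, one_mul, add_comm]
  let e : PrimaryProd k Φ ℓ := Pi.single ⟨F, hF⟩ (Ideal.Quotient.mk _ (monomial a 1))
  refine ⟨Submodule.Quotient.mk e, ?_, fun i => ?_⟩
  · rw [Ne, Submodule.Quotient.mk_eq_zero]
    rintro ⟨y, hy⟩
    obtain ⟨s, rfl⟩ := Ideal.Quotient.mk_surjective y
    have h1 := congrFun hy ⟨F, hF⟩
    have h2 := congrFun hy ⟨G, hG⟩
    simp only [e, diag_mk, Pi.single_eq_same] at h1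
    have hGF : (⟨G, hG⟩ : {H // H ∈ Φ}) ≠ ⟨F, hF⟩ := fun h => hFG (congrArg Subtype.val h).symm
    simp only [e, diag_mk, Pi.single_eq_of_ne hGF] at h2
    have h3 := (mem_monIdeal' (isUpperSet_degGE _ _)).1 (Ideal.Quotient.eq.1 h1) a haF
    have h4 := (mem_monIdeal' (isUpperSet_degGE _ _)).1 (Ideal.Quotient.eq_zero_iff_mem.1 h2) a haG
    rw [coeff_sub, h4, coeff_monomial, if_pos rfl, zero_sub, neg_eq_zero] at h3
    exact one_ne_zero h3
  · rw [← Submodule.Quotient.mk_smul, Submodule.Quotient.mk_eq_zero]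
    have h1 : (X i : MvPolynomial (Fin n) k) • e =
        (Pi.single ⟨F, hF⟩ (Ideal.Quotient.mk _ (monomial (a + Finsupp.single i 1) 1)) :
          PrimaryProd k Φ ℓ) := by
      rw [← hX, ← Pi.single_smul]
      rfl
    rw [h1]
    rcases ha i with h2 | h2
    · rw [Ideal.Quotient.eq_zero_iff_mem.2 (monomial_mem_monIdeal h2 1), Pi.single_zero]
      exact zero_mem _
    · refine ⟨Ideal.Quotient.mk _ (monomial (a + Finsupp.single i 1) 1), funext fun H => ?_⟩
      rw [diag_mk]
      by_cases hH : H = ⟨F, hF⟩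
      · subst hH
        rw [Pi.single_eq_same]
      · rw [Pi.single_eq_of_ne hH]
        exact Ideal.Quotient.eq_zero_iff_mem.2 (monomial_mem_monIdeal
          (h2 H.1 H.2 fun h => hH (Subtype.ext h)) 1)

lemma ext_residue_one_nontrivial (hΦ : ∀ H ∈ Φ, 2 ≤ H.card)
    {x : PrimaryProd k Φ ℓ ⧸ LinearMap.range (diag k Φ ℓ)} (hx : x ≠ 0)
    (h : ∀ i, (X i : MvPolynomial (Fin n) k) • x = 0) :
    Nontrivial (ModExt (MvPolynomial (Fin n) k)
      (FaceRing k (Finset.univ : Finset (Fin n))) (MonQuot k (symbSet Φ ℓ)) 1) := by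
  obtain ⟨f, -, hf⟩ := exists_residue_embedding hx h
  by_contra hn
  rw [not_nontrivial_iff_subsingleton] at hn
  exact not_subsingleton_iff_nontrivial.2 (modExt_zero_nontrivial hf)
    ((isSES_range (diag_injective Φ ℓ)).ext_right (primaryProd_ext_residue hΦ two_pos) hn)

lemma ext_residue_zero_subsingleton (hΦ : ∀ H ∈ Φ, 2 ≤ H.card) :
    Subsingleton (ModExt (MvPolynomial (Fin n) k)
      (FaceRing k (Finset.univ : Finset (Fin n))) (MonQuot k (symbSet Φ ℓ)) 0) :=
  (isSES_range (diag_injective Φ ℓ)).ext_left_zero (primaryProd_ext_residue hΦ two_pos)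

lemma ext_self_top_subsingleton (hΦ : ∀ H ∈ Φ, 2 ≤ H.card) :
    Subsingleton (ModExt (MvPolynomial (Fin n) k) (MonQuot k (symbSet Φ ℓ))
      (MvPolynomial (Fin n) k) n) :=
  (isSES_range (diag_injective Φ ℓ)).ext_left' (primaryProd_ext_self hΦ (by lia))
    (subsingleton_modExt_of_lt k n _ _ (Nat.lt_succ_self n))

lemma ext_self_nontrivial (hn : 0 < n) (hΦ : ∀ H ∈ Φ, 2 ≤ H.card)
    {x : PrimaryProd k Φ ℓ ⧸ LinearMap.range (diag k Φ ℓ)} (hx : x ≠ 0)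
    (h : ∀ i, (X i : MvPolynomial (Fin n) k) • x = 0) :
    Nontrivial (ModExt (MvPolynomial (Fin n) k) (MonQuot k (symbSet Φ ℓ))
      (MvPolynomial (Fin n) k) (n - 1)) := by
  obtain ⟨f, hf, -⟩ := exists_residue_embedding hx h
  by_contra hs
  rw [not_nontrivial_iff_subsingleton] at hs
  have h1 : n - 1 + 1 = n := by lia
  have h2 := (isSES_range (diag_injective Φ ℓ)).ext_right_succ' hs
    (primaryProd_ext_self hΦ (by lia))
  rw [h1] at h2
  have h3 := (isSES_range hf).ext_left' h2
    (subsingleton_modExt_of_lt k n _ _ (Nat.lt_succ_self n))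
  have hgen := faceRing_exists_generator k (Finset.univ : Finset (Fin n))
  rw [Finset.card_univ, Fintype.card_fin] at hgen
  obtain ⟨e, -, he⟩ := hgen
  have h4 := (mem_monIdeal (isUpperSet_degGE _ _)).1 ((he 1).1 (h3.elim _ _)) 0 (by simp)
  simp [mem_degGE_one] at h4

end Consequences

section DepthGE

variable (k : Type) [Field k] {n : ℕ}

/-- The quotient by the monomial ideal with exponents `U` has depth at least `r`. -/
def DepthGE (r : ℕ) (U : Set (Fin n →₀ ℕ)) : Prop :=
  ∀ i < r, Subsingleton (ModExt (MvPolynomial (Fin n) k)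
    (FaceRing k (Finset.univ : Finset (Fin n))) (MonQuot k U) i)

lemma depthGE_degGE {r : ℕ} {A : Finset (Fin n)} (h : r + A.card ≤ n) :
    DepthGE k r (degGE A 1) := fun i hi =>
  (faceRing_depth k (n - A.card) A (by lia)).1 i (by lia)

variable {k}

lemma DepthGE.of_colon {r : ℕ} {U : Set (Fin n →₀ ℕ)} (hU : IsUpperSet U) (c : Fin n →₀ ℕ)
    (h₁ : DepthGE k r {b | b + c ∈ U}) (h₂ : DepthGE k r {b | b ∈ U ∨ c ≤ b}) :
    DepthGE k r U := by
  obtain ⟨f, g, h, -⟩ := exists_isSES_monomial (k := k) (U₁ := {b | b + c ∈ U})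
    (U₂ := {b | b ∈ U ∨ c ≤ b}) hU c (fun _ => Iff.rfl) (fun _ => Iff.rfl)
  exact fun i hi => h.ext_middle (h₁ i hi) (h₂ i hi)

lemma DepthGE.add_multiples {r : ℕ} {U : Set (Fin n →₀ ℕ)} (hU : IsUpperSet U) (c : Fin n →₀ ℕ)
    (h₁ : DepthGE k (r + 1) {b | b + c ∈ U}) (h₂ : DepthGE k r U) :
    DepthGE k r {b | b ∈ U ∨ c ≤ b} := by
  obtain ⟨f, g, h, -⟩ := exists_isSES_monomial (k := k) (U₁ := {b | b + c ∈ U})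
    (U₂ := {b | b ∈ U ∨ c ≤ b}) hU c (fun _ => Iff.rfl) (fun _ => Iff.rfl)
  exact fun i hi => h.ext_right (h₂ i hi) (h₁ (i + 1) (by lia))

/-- The exponents lying in `U` or above an element of `C`. -/
def addMultiples (U : Set (Fin n →₀ ℕ)) (C : Finset (Fin n →₀ ℕ)) : Set (Fin n →₀ ℕ) :=
  {b | b ∈ U ∨ ∃ c ∈ C, c ≤ b}

lemma addMultiples_empty (U : Set (Fin n →₀ ℕ)) : addMultiples U ∅ = U := by
  simp [addMultiples]

lemma isUpperSet_addMultiples {U : Set (Fin n →₀ ℕ)} (hU : IsUpperSet U)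
    (C : Finset (Fin n →₀ ℕ)) : IsUpperSet (addMultiples U C) := fun _ _ hab =>
  Or.imp (fun h => hU hab h) fun ⟨c, hc, h⟩ => ⟨c, hc, h.trans hab⟩

lemma DepthGE.of_addMultiples {r : ℕ} {U : Set (Fin n →₀ ℕ)} (hU : IsUpperSet U)
    {C : Finset (Fin n →₀ ℕ)}
    (h : ∀ c ∈ C, ∀ C' ⊆ C, c ∉ C' → DepthGE k r {b | b + c ∈ addMultiples U C'})
    (hC : DepthGE k r (addMultiples U C)) : ∀ C' ⊆ C, DepthGE k r (addMultiples U C') := by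
  intro C' hC'
  obtain ⟨m, hm⟩ : ∃ m, (C \ C').card = m := ⟨_, rfl⟩
  induction m generalizing C' with
  | zero =>
    rw [Finset.card_eq_zero, Finset.sdiff_eq_empty_iff_subset] at hm
    rwa [subset_antisymm hC' hm]
  | succ m ih =>
    obtain ⟨c, hc⟩ := Finset.card_pos.1 (by rw [hm]; exact Nat.succ_pos m)
    obtain ⟨hcC, hcC'⟩ := Finset.mem_sdiff.1 hc
    refine .of_colon (isUpperSet_addMultiples hU C') c (h c hcC C' hC' hcC') ?_
    have h1 := ih (insert c C') (Finset.insert_subset hcC hC') (by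
      rw [Finset.sdiff_insert, Finset.card_erase_of_mem hc, hm, Nat.add_sub_cancel])
    convert h1 using 2
    ext b
    simp only [addMultiples, Set.mem_ofPred_eq, Finset.exists_mem_insert]
    rw [or_assoc, or_comm (a := c ≤ b)]

end DepthGE

section Squarefree

variable {k : Type} [Field k] {n : ℕ}

/-- The exponent of the product of the variables from `B`. -/
noncomputable def ind (B : Finset (Fin n)) : Fin n →₀ ℕ :=
  Finsupp.equivFunOnFinite.symm fun i => if i ∈ B then 1 else 0

lemma ind_apply (B : Finset (Fin n)) (i : Fin n) : ind B i = if i ∈ B then 1 else 0 := rfl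

lemma ind_le_iff {B : Finset (Fin n)} {b : Fin n →₀ ℕ} : ind B ≤ b ↔ ∀ i ∈ B, 0 < b i := by
  rw [Finsupp.le_def]
  refine forall_congr' fun i => ?_
  rw [ind_apply]
  split_ifs with h <;> simp [h, Nat.succ_le_iff]

lemma sum_ind (A B : Finset (Fin n)) : ∑ i ∈ A, ind B i = (A ∩ B).card := by
  simp [ind_apply]

/-- Exponents of the ideal generated by the variables from `A` and the squarefree monomials of
degree `r + 1` in the variables from `T`. -/
def sqfreeSet (T : Finset (Fin n)) (r : ℕ) (A : Finset (Fin n)) : Set (Fin n →₀ ℕ) :=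
  {b | b ∈ degGE A 1 ∨ r + 1 ≤ (T.filter (0 < b ·)).card}

lemma isUpperSet_sqfreeSet (T : Finset (Fin n)) (r : ℕ) (A : Finset (Fin n)) :
    IsUpperSet (sqfreeSet T r A) := fun _ _ hab => Or.imp (fun h => isUpperSet_degGE A 1 hab h)
  fun h => h.trans (Finset.card_le_card (Finset.monotone_filter_right T fun i _ hi =>
    lt_of_lt_of_le hi (hab i)))

lemma depthGE_sqfreeSet (T : Finset (Fin n)) : ∀ {r m : ℕ} {A : Finset (Fin n)}, r ≤ T.card →
    Disjoint A T → m + A.card + T.card ≤ n + r → DepthGE k m (sqfreeSet T r A) := by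
  induction T using Finset.induction_on with
  | empty =>
    intro r m A hr _ h
    rw [Finset.card_empty] at hr h
    have : sqfreeSet ∅ r A = degGE A 1 := by
      ext b
      simp [sqfreeSet]
    rw [this]
    exact depthGE_degGE k (by lia)
  | insert t T ht ih =>
    intro r m A hr hd h
    rw [Finset.card_insert_of_notMem ht] at hr h
    rw [Finset.disjoint_insert_right] at hd
    rcases hr.eq_or_lt with hr1 | hr1
    · have : sqfreeSet (insert t T) r A = degGE A 1 := by
        ext b
        refine or_iff_left fun h1 => ?_
        have h2 := Finset.card_filter_le (insert t T) (0 < b ·)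
        rw [Finset.card_insert_of_notMem ht] at h2
        lia
      rw [this]
      exact depthGE_degGE k (by lia)
    rcases r.eq_zero_or_pos with rfl | hr0
    · have : sqfreeSet (insert t T) 0 A = degGE (A ∪ insert t T) 1 := by
        ext b
        simp only [sqfreeSet, Set.mem_ofPred_eq, mem_degGE_one, zero_add, Finset.one_le_card,
          Finset.filter_nonempty_iff, Finset.mem_union, or_and_right, exists_or]
      rw [this]
      refine depthGE_degGE k ?_
      have h1 := Finset.card_union_le A (insert t T)
      rw [Finset.card_insert_of_notMem ht] at h1
      lia
    · refine .of_colon (isUpperSet_sqfreeSet _ _ _) (Finsupp.single t 1) ?_ ?_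
      · have : {b | b + Finsupp.single t 1 ∈ sqfreeSet (insert t T) r A} =
            sqfreeSet T (r - 1) A := by
          ext b
          have h1 : T.filter (fun i => 0 < (b + Finsupp.single t 1 : Fin n →₀ ℕ) i) = T.filter (0 < b ·) :=
            Finset.filter_congr fun i hi => by
              rw [Finsupp.add_apply, Finsupp.single_eq_of_ne (ne_of_mem_of_not_mem hi ht), add_zero]
          have h2 : (insert t T).filter (fun i => 0 < (b + Finsupp.single t 1 : Fin n →₀ ℕ) i) =
              insert t (T.filter (0 < b ·)) := by
            rw [Finset.filter_insert, if_pos (by simp), h1]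
          have h3 : b + Finsupp.single t 1 ∈ degGE A 1 ↔ b ∈ degGE A 1 := by
            simp only [mem_degGE_one]
            refine exists_congr fun i => and_congr_right fun hi => ?_
            rw [Finsupp.add_apply, Finsupp.single_eq_of_ne (ne_of_mem_of_not_mem hi hd.1), add_zero]
          simp only [sqfreeSet, Set.mem_ofPred_eq, h2, h3]
          rw [Finset.card_insert_of_notMem (fun h => ht (Finset.mem_of_mem_filter _ h))]
          refine or_congr_right ?_
          lia
        rw [this]
        exact ih (by lia) hd.2 (by lia)
      · have : {b | b ∈ sqfreeSet (insert t T) r A ∨ Finsupp.single t 1 ≤ b} =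
            sqfreeSet T r (insert t A) := by
          ext b
          have h3 : b ∈ degGE (insert t A) 1 ↔ 0 < b t ∨ b ∈ degGE A 1 := by
            simp only [mem_degGE_one, Finset.exists_mem_insert]
          simp only [sqfreeSet, Set.mem_ofPred_eq, h3, Finsupp.single_le_iff, Nat.one_le_iff_ne_zero,
            ← Nat.pos_iff_ne_zero, Finset.filter_insert]
          by_cases h4 : 0 < b t
          · simp [h4]
          · simp only [h4, if_false]
            tauto
        rw [this]
        refine ih (by lia) (Finset.disjoint_insert_left.2 ⟨ht, hd.2⟩) ?_
        rw [Finset.card_insert_of_notMem hd.1]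
        lia

end Squarefree

section UniformSecondPower

variable {k : Type} [Field k] {n : ℕ}

/-- Exponents of the second symbolic power of the ideal generated by the squarefree monomials of
degree `r + 1` in the variables from `W`. -/
def uniformSet (W : Finset (Fin n)) (r : ℕ) : Set (Fin n →₀ ℕ) :=
  {b | ∀ A ⊆ W, A.card = r → b ∈ degGE (W \ A) 2}

lemma isUpperSet_uniformSet (W : Finset (Fin n)) (r : ℕ) : IsUpperSet (uniformSet W r) :=
  fun _ _ hab h A hA hr => isUpperSet_degGE _ 2 hab (h A hA hr)

lemma sum_add_ind (A B : Finset (Fin n)) (b : Fin n →₀ ℕ) :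
    ∑ i ∈ A, (b + ind B) i = ∑ i ∈ A, b i + (A ∩ B).card := by
  simp only [Finsupp.add_apply, Finset.sum_add_distrib, sum_ind]

lemma add_ind_mem_uniformSet {W B : Finset (Fin n)} {r : ℕ} (hB : B ⊆ W) (hr : B.card = r + 1)
    (b : Fin n →₀ ℕ) :
    b + ind B ∈ uniformSet W r ↔ b ∈ degGE (W \ B) 1 ∨ ind B ≤ b := by
  rw [ind_le_iff]
  have key (A : Finset (Fin n)) : (W \ A ∩ B).card = (B \ A).card := by
    congr 1
    grind
  constructor
  · intro h
    by_contra! hc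
    obtain ⟨h1, x, hx, hbx⟩ := hc
    have h2 := h (B.erase x) ((Finset.erase_subset _ _).trans hB)
      (by rw [Finset.card_erase_of_mem hx, hr, Nat.add_sub_cancel])
    rw [degGE, Set.mem_ofPred_eq, sum_add_ind, key] at h2
    have h3 : B \ B.erase x = {x} := by grind
    have h4 : ∑ i ∈ W \ B.erase x, b i = 0 := by
      refine Finset.sum_eq_zero fun i hi => ?_
      rcases eq_or_ne i x with rfl | hix
      · lia
      · by_contra h0
        exact h1 (mem_degGE_one.2 ⟨i, by grind, Nat.pos_of_ne_zero h0⟩)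
    rw [h3, h4, Finset.card_singleton] at h2
    lia
  · intro h A hA hAr
    rw [degGE, Set.mem_ofPred_eq, sum_add_ind, key]
    have h1 : 1 ≤ (B \ A).card := by
      have := Finset.le_card_sdiff A B
      lia
    rcases h1.eq_or_lt with h1 | h1
    · have hAB : A ⊆ B := by
        have h2 := Finset.card_sdiff_add_card_inter B A
        have h3 : (B ∩ A).card = A.card := by lia
        rw [← Finset.eq_of_subset_of_card_le Finset.inter_subset_right h3.ge]
        exact Finset.inter_subset_left
      have h4 : 0 < ∑ i ∈ W \ A, b i := by
        rw [Finset.sum_pos_iff]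
        rcases h with h | h
        · obtain ⟨i, hi, hb⟩ := mem_degGE_one.1 h
          exact ⟨i, by grind, hb⟩
        · obtain ⟨x, hx⟩ := Finset.card_pos.1 (by lia : 0 < (B \ A).card)
          exact ⟨x, by grind, h x (by grind)⟩
      lia
    · lia

lemma depthGE_uniformSet {W : Finset (Fin n)} {r m : ℕ} (hr : r ≤ W.card)
    (h : m + W.card ≤ n + r) : DepthGE k m (uniformSet W r) := by
  have hU := isUpperSet_uniformSet W r
  rw [← addMultiples_empty (uniformSet W r)]
  refine DepthGE.of_addMultiples hU (C := (W.powersetCard (r + 1)).image ind) ?_ ?_ ∅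
    (Finset.empty_subset _)
  · intro c hc C' hC' hcC'
    obtain ⟨B, hB, rfl⟩ := Finset.mem_image.1 hc
    obtain ⟨hBW, hBr⟩ := Finset.mem_powersetCard.1 hB
    have h1 : {b | b + ind B ∈ addMultiples (uniformSet W r) C'} =
        {b | b ∈ degGE (W \ B) 1 ∨ ind B ≤ b} := by
      ext b
      simp only [addMultiples, Set.mem_ofPred_eq, add_ind_mem_uniformSet hBW hBr]
      refine or_iff_left_of_imp ?_
      rintro ⟨c, hc, hcb⟩
      obtain ⟨B', hB', rfl⟩ := Finset.mem_image.1 (hC' hc)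
      obtain ⟨hBW', hBr'⟩ := Finset.mem_powersetCard.1 hB'
      have hne : ¬ B' ⊆ B := fun hs =>
        hcC' (Finset.eq_of_subset_of_card_le hs (by lia) ▸ hc)
      obtain ⟨y, hy, hyB⟩ := Finset.not_subset.1 hne
      refine Or.inl (mem_degGE_one.2 ⟨y, Finset.mem_sdiff.2 ⟨hBW' hy, hyB⟩, ?_⟩)
      have h2 := ind_le_iff.1 hcb y hy
      rwa [Finsupp.add_apply, ind_apply, if_neg hyB, add_zero] at h2
    have hcard := Finset.card_sdiff_add_card_eq_card hBW
    rw [h1]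
    refine DepthGE.add_multiples (isUpperSet_degGE _ 1) _ ?_ (depthGE_degGE k (by lia))
    have h2 : {b | b + ind B ∈ degGE (W \ B) 1} = degGE (W \ B) 1 := by
      ext b
      simp only [degGE, Set.mem_ofPred_eq, sum_add_ind, Finset.sdiff_inter_self,
        Finset.card_empty, add_zero]
    rw [h2]
    exact depthGE_degGE k (by lia)
  · have h1 : addMultiples (uniformSet W r) ((W.powersetCard (r + 1)).image ind) =
        sqfreeSet W r ∅ := by
      ext b
      simp only [addMultiples, sqfreeSet, Set.mem_ofPred_eq, mem_degGE_one, Finset.notMem_empty,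
        false_and, exists_false, false_or]
      constructor
      · rintro (hb | ⟨c, hc, hcb⟩)
        · by_contra! hlt
          obtain ⟨A, hA, hAW, hAr⟩ := Finset.exists_subsuperset_card_eq
            (Finset.filter_subset (0 < b ·) W) (Nat.le_of_lt_succ hlt) hr
          have h2 := hb A hAW hAr
          have h3 : ∑ i ∈ W \ A, b i = 0 := Finset.sum_eq_zero fun i hi => by
            by_contra h0
            exact (Finset.mem_sdiff.1 hi).2 (hA (Finset.mem_filter.2
              ⟨(Finset.mem_sdiff.1 hi).1, Nat.pos_of_ne_zero h0⟩))
          rw [degGE, Set.mem_ofPred_eq, h3] at h2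
          lia
        · obtain ⟨B, hB, rfl⟩ := Finset.mem_image.1 hc
          obtain ⟨hBW, hBr⟩ := Finset.mem_powersetCard.1 hB
          rw [← hBr]
          exact Finset.card_le_card fun i hi =>
            Finset.mem_filter.2 ⟨hBW hi, ind_le_iff.1 hcb i hi⟩
      · intro hle
        obtain ⟨B, hB, hBr⟩ := Finset.exists_subset_card_eq hle
        refine Or.inr ⟨ind B, Finset.mem_image_of_mem _ (Finset.mem_powersetCard.2
          ⟨hB.trans (Finset.filter_subset _ _), hBr⟩), ind_le_iff.2 fun i hi =>
            (Finset.mem_filter.1 (hB hi)).2⟩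
    rw [h1]
    exact depthGE_sqfreeSet W hr (Finset.disjoint_empty_left W) (by simpa using h)

end UniformSecondPower

section AddPrime

variable {k : Type} [Field k] {n : ℕ}

lemma add_mem_inter_degGE_two {U : Set (Fin n →₀ ℕ)} {P : Finset (Fin n)} (hU : IsUpperSet U)
    {c : Fin n →₀ ℕ} (hc : c ∈ U) (hcP : ∑ i ∈ P, c i = 1) (b : Fin n →₀ ℕ) :
    b + c ∈ U ∩ degGE P 2 ↔ b ∈ degGE P 1 := by
  rw [Set.mem_inter_iff, and_iff_right (hU le_add_self hc)]
  simp only [degGE, Set.mem_ofPred_eq, Finsupp.add_apply, Finset.sum_add_distrib, hcP]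
  lia

/-- Intersecting with the square of a monomial prime `(x_i : i ∈ P)`, when every element outside
is a multiple of `c₀` or of one of the `c p`, where `c p` is linear in the variables from `P`. -/
lemma depthGE_inter_degGE_two {r : ℕ} {U : Set (Fin n →₀ ℕ)} {P : Finset (Fin n)}
    (hU : IsUpperSet U) (hr : r + P.card ≤ n) (hd : DepthGE k r U)
    {c : Fin n → Fin n →₀ ℕ} {c₀ : Fin n →₀ ℕ} (hc : ∀ p ∈ P, c p ∈ U)
    (hcP : ∀ p ∈ P, ∀ q ∈ P, c p q = if q = p then 1 else 0) (hc₀ : c₀ ∈ U)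
    (hc₀P : ∀ q ∈ P, c₀ q = 0) (hcc : ∀ p ∈ P, c p ≤ Finsupp.single p 1 + c₀)
    (h : ∀ b ∈ U, b ∉ degGE P 2 → c₀ ≤ b ∨ ∃ p ∈ P, c p ≤ b) :
    DepthGE k r (U ∩ degGE P 2) ∧ (0 < r → r + P.card = n → P.Nonempty →
      Nontrivial (ModExt (MvPolynomial (Fin n) k) (FaceRing k (Finset.univ : Finset (Fin n)))
        (MonQuot k (U ∩ degGE P 2)) r)) := by
  have hUP : IsUpperSet (U ∩ degGE P 2) := hU.inter (isUpperSet_degGE P 2)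
  have hsum : ∀ p ∈ P, ∑ i ∈ P, c p i = 1 := fun p hp => by
    rw [Finset.sum_congr rfl (hcP p hp), Finset.sum_ite_eq', if_pos hp]
  have hpos {p : Fin n} (hp : p ∈ P) {b : Fin n →₀ ℕ} {e : Fin n →₀ ℕ} (he : e p = 0)
      (hb : c p ≤ b + e) : b ∈ degGE P 1 := by
    refine mem_degGE_one.2 ⟨p, hp, ?_⟩
    have h1 := hb p
    rw [hcP p hp p hp, if_pos rfl, Finsupp.add_apply, he] at h1
    lia
  suffices key : ∀ C ⊆ P.image c, DepthGE k r (addMultiples (U ∩ degGE P 2) C) by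
    refine ⟨by simpa only [addMultiples_empty] using key ∅ (Finset.empty_subset _),
      fun hr0 hrn ⟨p, hp⟩ => ?_⟩
    have h1 := key {c p} (Finset.singleton_subset_iff.2 (Finset.mem_image_of_mem c hp))
    obtain ⟨f, g, hfg, -⟩ := exists_isSES_monomial (k := k) (U₁ := degGE P 1)
      (U₂ := addMultiples (U ∩ degGE P 2) {c p}) hUP (c p)
      (fun b => (add_mem_inter_degGE_two hU (hc p hp) (hsum p hp) b).symm)
      (fun b => by simp [addMultiples])
    by_contra hs
    rw [not_nontrivial_iff_subsingleton] at hs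
    obtain ⟨s, rfl⟩ := Nat.exists_eq_add_of_le' hr0
    exact not_subsingleton_iff_nontrivial.2 (faceRing_depth k (s + 1) P (by lia)).2
      (hfg.ext_left_succ (h1 s (Nat.lt_succ_self s)) hs)
  refine DepthGE.of_addMultiples hUP ?_ ?_
  · intro e he C' hC' heC'
    obtain ⟨p, hp, rfl⟩ := Finset.mem_image.1 he
    have h1 : {b | b + c p ∈ addMultiples (U ∩ degGE P 2) C'} = degGE P 1 := by
      ext b
      simp only [addMultiples, Set.mem_ofPred_eq,
        add_mem_inter_degGE_two hU (hc p hp) (hsum p hp)]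
      refine or_iff_left_of_imp ?_
      rintro ⟨e, he, hb⟩
      obtain ⟨q, hq, rfl⟩ := Finset.mem_image.1 (hC' he)
      have hqp : q ≠ p := by
        rintro rfl
        exact heC' ‹_›
      exact hpos hq (by rw [hcP p hp q hq, if_neg hqp]) hb
    rw [h1]
    exact depthGE_degGE k hr
  · refine .of_colon (isUpperSet_addMultiples hUP _) c₀ ?_ ?_
    · have h1 : {b | b + c₀ ∈ addMultiples (U ∩ degGE P 2) (P.image c)} = degGE P 1 := by
        ext b
        simp only [addMultiples, Set.mem_ofPred_eq]
        constructor
        · rintro (⟨-, hb⟩ | ⟨e, he, hb⟩)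
          · simp only [degGE, Set.mem_ofPred_eq, Finsupp.add_apply, Finset.sum_add_distrib,
              Finset.sum_eq_zero hc₀P] at hb ⊢
            lia
          · obtain ⟨p, hp, rfl⟩ := Finset.mem_image.1 he
            exact hpos hp (hc₀P p hp) hb
        · intro hb
          obtain ⟨p, hp, hbp⟩ := mem_degGE_one.1 hb
          exact Or.inr ⟨c p, Finset.mem_image_of_mem _ hp, (hcc p hp).trans
            (add_le_add_left (Finsupp.single_le_iff.2 hbp) c₀)⟩
      rw [h1]
      exact depthGE_degGE k hr
    · have h1 : {b | b ∈ addMultiples (U ∩ degGE P 2) (P.image c) ∨ c₀ ≤ b} = U := by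
        ext b
        simp only [addMultiples, Set.mem_ofPred_eq]
        constructor
        · rintro ((⟨hb, -⟩ | ⟨e, he, hb⟩) | hb)
          · exact hb
          · obtain ⟨p, hp, rfl⟩ := Finset.mem_image.1 he
            exact hU hb (hc p hp)
          · exact hU hb hc₀
        · intro hb
          by_cases hP : b ∈ degGE P 2
          · exact Or.inl (Or.inl ⟨hb, hP⟩)
          · refine (h b hb hP).symm.imp ?_ id
            rintro ⟨p, hp, hpb⟩
            exact Or.inr ⟨c p, Finset.mem_image_of_mem _ hp, hpb⟩
      rw [h1]
      exact hd

/-- Variant of `depthGE_inter_degGE_two` for the prime complementary to a facet `F`. -/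
lemma depthGE_inter_degGE_insert {r : ℕ} {U : Set (Fin n →₀ ℕ)} {F G : Finset (Fin n)}
    {z : Fin n} (hFG : Disjoint F G) (hzF : z ∉ F) (hzG : z ∉ G) (hU : IsUpperSet U)
    (hr : r + G.card + 1 ≤ n) (hd : DepthGE k r U)
    (h₁ : ∀ y ∈ G, ind F + Finsupp.single y 1 ∈ U) (h₂ : ind F + ind F ∈ U)
    (h₃ : ∀ b ∈ U, ∀ x ∈ F, 2 ≤ b x + ∑ i ∈ G, b i) :
    DepthGE k r (U ∩ degGE (insert z G) 2) ∧ (0 < r → r + G.card + 1 = n →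
      Nontrivial (ModExt (MvPolynomial (Fin n) k) (FaceRing k (Finset.univ : Finset (Fin n)))
        (MonQuot k (U ∩ degGE (insert z G) 2)) r)) := by
  have hF0 {q : Fin n} (hq : q ∈ insert z G) : ind F q = 0 := by
    rw [ind_apply, if_neg]
    rcases Finset.mem_insert.1 hq with rfl | hq
    · exact hzF
    · exact Finset.disjoint_right.1 hFG hq
  have hcard := Finset.card_insert_of_notMem hzG
  refine (depthGE_inter_degGE_two
    (c := fun p => ind F + Finsupp.single p 1 + if p = z then ind F else 0)
    (c₀ := ind F + ind F) hU (by lia) hd ?_ ?_ h₂ ?_ ?_ ?_).imp_right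
      fun h hr0 hrn => h hr0 (by lia) (Finset.insert_nonempty z G)
  · intro p hp
    rcases Finset.mem_insert.1 hp with rfl | hp
    · rw [if_pos rfl, add_right_comm]
      exact hU le_self_add h₂
    · rw [if_neg (ne_of_mem_of_not_mem hp hzG), add_zero]
      exact h₁ p hp
  · intro p hp q hq
    rw [Finsupp.add_apply, Finsupp.add_apply, hF0 hq, Finsupp.single_apply]
    have h4 : (if p = z then ind F else 0 : Fin n →₀ ℕ) q = 0 := by
      split_ifs
      · exact hF0 hq
      · rfl
    rw [h4, zero_add, add_zero]
    simp only [eq_comm]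
  · intro q hq
    rw [Finsupp.add_apply, hF0 hq]
  · intro p hp
    rw [add_comm (ind F), add_assoc]
    refine add_le_add_right (add_le_add_right ?_ _) _
    split_ifs
    · exact le_rfl
    · exact zero_le
  · intro b hb hP
    rw [degGE, Set.mem_ofPred_eq, Finset.sum_insert hzG] at hP
    have key := h₃ b hb
    by_cases hG : ∃ y ∈ G, 0 < b y
    · obtain ⟨y, hy, hby⟩ := hG
      refine Or.inr ⟨y, Finset.mem_insert_of_mem hy, fun i => ?_⟩
      rw [if_neg (ne_of_mem_of_not_mem hy hzG), add_zero, Finsupp.add_apply]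
      have h4 := Finset.single_le_sum (f := b) (fun _ _ => Nat.zero_le _) hy
      by_cases hi : i ∈ F
      · have h5 := key i hi
        rw [ind_apply, if_pos hi, Finsupp.single_eq_of_ne]
        · lia
        · rintro rfl
          exact Finset.disjoint_left.1 hFG hi hy
      · rw [ind_apply, if_neg hi, zero_add, Finsupp.single_apply]
        split_ifs with hyi
        · exact hyi ▸ hby
        · exact Nat.zero_le _
    · push Not at hG
      have hG0 : ∑ i ∈ G, b i = 0 := Finset.sum_eq_zero fun i hi => Nat.le_zero.1 (hG i hi)
      refine Or.inl fun i => ?_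
      rw [Finsupp.add_apply, ind_apply]
      split_ifs with hi
      · have := key i hi
        lia
      · exact Nat.zero_le _

end AddPrime

section SecondPower

variable (k : Type) [Field k] {n : ℕ}

/-- The quotient by the second symbolic power is Cohen–Macaulay, in terms of `Ext`. -/
lemma depthGE_secondPower {d : ℕ} {F G : Finset (Fin n)} {z : Fin n} (hd : 2 ≤ d)
    (hn : n = 2 * d + 1) (hFG : Disjoint F G) (hzF : z ∉ F) (hzG : z ∉ G)
    (hF : F.card = d) (hG : G.card = d) :
    DepthGE k d (uniformSet (F ∪ G) (d - 1) ∩ degGE (insert z F) 2 ∩ degGE (insert z G) 2) ∧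
      Nontrivial (ModExt (MvPolynomial (Fin n) k) (FaceRing k (Finset.univ : Finset (Fin n)))
        (MonQuot k
          (uniformSet (F ∪ G) (d - 1) ∩ degGE (insert z F) 2 ∩ degGE (insert z G) 2)) d) := by
  have hW : (F ∪ G).card = 2 * d := by
    rw [Finset.card_union_of_disjoint hFG]
    lia
  have hL : DepthGE k d (uniformSet (F ∪ G) (d - 1)) := depthGE_uniformSet (by lia) (by lia)
  have h₁ {F G : Finset (Fin n)} (hFG : Disjoint F G) (hF : F.card = d) :
      ∀ y ∈ G, ind F + Finsupp.single y 1 ∈ uniformSet (F ∪ G) (d - 1) := by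
    intro y hy
    have hyF := Finset.disjoint_right.1 hFG hy
    have h4 : ind F + Finsupp.single y 1 = 0 + ind (insert y F) := by
      ext i
      rw [Finsupp.add_apply, zero_add, ind_apply, ind_apply, Finsupp.single_apply]
      grind
    intro A hA hAd
    rw [degGE, Set.mem_ofPred_eq, h4, sum_add_ind]
    have h5 : (F ∪ G) \ A ∩ insert y F = insert y F \ A := by grind
    have h6 := Finset.le_card_sdiff A (insert y F)
    rw [Finset.card_insert_of_notMem hyF] at h6
    rw [h5]
    lia
  have h₂ {F G : Finset (Fin n)} (hF : F.card = d) :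
      ind F + ind F ∈ uniformSet (F ∪ G) (d - 1) := by
    intro A hA hAd
    rw [degGE, Set.mem_ofPred_eq, sum_add_ind, sum_ind]
    have h5 : (F ∪ G) \ A ∩ F = F \ A := by grind
    have h6 := Finset.le_card_sdiff A F
    rw [h5]
    lia
  have h₃ {F G : Finset (Fin n)} (hFG : Disjoint F G) (hF : F.card = d) :
      ∀ b ∈ uniformSet (F ∪ G) (d - 1), ∀ x ∈ F, 2 ≤ b x + ∑ i ∈ G, b i := by
    intro b hb x hx
    have h4 := hb (F.erase x) ((Finset.erase_subset _ _).trans Finset.subset_union_left)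
      (by rw [Finset.card_erase_of_mem hx, hF])
    have h5 : (F ∪ G) \ F.erase x = insert x G := by
      have := Finset.disjoint_left.1 hFG
      grind
    rwa [degGE, Set.mem_ofPred_eq, h5,
      Finset.sum_insert (Finset.disjoint_left.1 hFG hx)] at h4
  have hLG : DepthGE k d (uniformSet (F ∪ G) (d - 1) ∩ degGE (insert z F) 2) := by
    rw [Finset.union_comm] at hL ⊢
    exact (depthGE_inter_degGE_insert hFG.symm hzG hzF (isUpperSet_uniformSet _ _) (by lia) hL
      (h₁ hFG.symm hG) (h₂ hG) (h₃ hFG.symm hG)).1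
  have hFz (e : Fin n →₀ ℕ) : ind F + e ∈ degGE (insert z F) 2 := by
    rw [add_comm, degGE, Set.mem_ofPred_eq, sum_add_ind, Finset.inter_eq_right.2
      (Finset.subset_insert z F)]
    lia
  refine (depthGE_inter_degGE_insert hFG hzF hzG
    ((isUpperSet_uniformSet _ _).inter (isUpperSet_degGE _ _)) (by lia) hLG
    (fun y hy => ⟨h₁ hFG hF y hy, hFz _⟩) ⟨h₂ hF, hFz _⟩ fun b hb => h₃ hFG hF b hb.1).imp_right
      fun h => h (by lia) (by lia)

end SecondPower

section Facets

variable {n : ℕ}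

/-- The vertices are split into two disjoint `d`-subsets `F` and `G` and a further vertex `z`. -/
structure IsSplitting (d : ℕ) (F G : Finset (Fin n)) (z : Fin n) : Prop where
  le_d : 3 ≤ d
  disjoint : Disjoint F G
  notMem_left : z ∉ F
  notMem_right : z ∉ G
  card_left : F.card = d
  card_right : G.card = d
  cover : insert z (F ∪ G) = Finset.univ

/-- The `d`-subsets containing `z`, together with `F` and `G`. -/
def splitFacets (d : ℕ) (F G : Finset (Fin n)) (z : Fin n) : Finset (Finset (Fin n)) :=
  Finset.univ.filter fun H => H = F ∨ H = G ∨ z ∈ H ∧ H.card = d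

lemma mem_splitFacets {d : ℕ} {F G : Finset (Fin n)} {z : Fin n} {H : Finset (Fin n)} :
    H ∈ splitFacets d F G z ↔ H = F ∨ H = G ∨ z ∈ H ∧ H.card = d := by
  simp [splitFacets]

namespace IsSplitting

variable {d : ℕ} {F G : Finset (Fin n)} {z : Fin n}

lemma symm (h : IsSplitting d F G z) : IsSplitting d G F z where
  le_d := h.le_d
  disjoint := h.disjoint.symm
  notMem_left := h.notMem_right
  notMem_right := h.notMem_left
  card_left := h.card_right
  card_right := h.card_left
  cover := by rw [Finset.union_comm, h.cover]

lemma card_eq (h : IsSplitting d F G z) : n = 2 * d + 1 := by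
  have h1 := congrArg Finset.card h.cover
  rw [Finset.card_insert_of_notMem (by simp [h.notMem_left, h.notMem_right]),
    Finset.card_union_of_disjoint h.disjoint, h.card_left, h.card_right, Finset.card_univ,
    Fintype.card_fin] at h1
  lia

lemma eq_or_mem (h : IsSplitting d F G z) (i : Fin n) : i = z ∨ i ∈ F ∨ i ∈ G := by
  have h1 := Finset.mem_univ i
  rwa [← h.cover, Finset.mem_insert, Finset.mem_union] at h1

lemma compl_left (h : IsSplitting d F G z) : Fᶜ = insert z G := by
  ext i
  rw [Finset.mem_compl]
  have h1 := Finset.disjoint_left.1 h.disjoint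
  have h2 := h.eq_or_mem i
  have h3 := h.notMem_left
  grind

lemma compl_right (h : IsSplitting d F G z) : Gᶜ = insert z F := h.symm.compl_left

lemma compl_insert (h : IsSplitting d F G z) (A : Finset (Fin n)) :
    (insert z A)ᶜ = (F ∪ G) \ A := by
  ext i
  rw [Finset.mem_compl]
  have h2 := h.eq_or_mem i
  have h3 := h.notMem_left
  have h4 := h.notMem_right
  grind

lemma left_ne_right (h : IsSplitting d F G z) : F ≠ G := by
  rintro rfl
  have h1 := h.card_left
  have h2 := h.le_d
  rw [disjoint_self.1 h.disjoint, Finset.bot_eq_empty, Finset.card_empty] at h1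
  lia

lemma left_mem : F ∈ splitFacets d F G z := mem_splitFacets.2 (Or.inl rfl)

lemma right_mem : G ∈ splitFacets d F G z := mem_splitFacets.2 (Or.inr (Or.inl rfl))

lemma insert_mem (h : IsSplitting d F G z) {A : Finset (Fin n)} (hA : A ⊆ F ∪ G)
    (hc : A.card = d - 1) : insert z A ∈ splitFacets d F G z := by
  have hz : z ∉ A := fun hz => by
    have h1 := hA hz
    simp [h.notMem_left, h.notMem_right] at h1
  have := h.le_d
  refine mem_splitFacets.2 (Or.inr (Or.inr ⟨Finset.mem_insert_self z A, ?_⟩))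
  rw [Finset.card_insert_of_notMem hz]
  lia

lemma mem_cases (h : IsSplitting d F G z) {H : Finset (Fin n)} (hH : H ∈ splitFacets d F G z) :
    H = F ∨ H = G ∨ ∃ A ⊆ F ∪ G, A.card = d - 1 ∧ H = insert z A := by
  refine (mem_splitFacets.1 hH).imp_right (Or.imp_right ?_)
  rintro ⟨hz, hc⟩
  refine ⟨H.erase z, fun i hi => ?_, by rw [Finset.card_erase_of_mem hz, hc],
    (Finset.insert_erase hz).symm⟩
  rw [Finset.mem_union]
  exact (h.eq_or_mem i).resolve_left (Finset.ne_of_mem_erase hi)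

lemma card_of_mem (h : IsSplitting d F G z) : ∀ H ∈ splitFacets d F G z, H.card = d := by
  intro H hH
  rcases mem_splitFacets.1 hH with rfl | rfl | ⟨-, hc⟩
  · exact h.card_left
  · exact h.card_right
  · exact hc

lemma two_le_card (h : IsSplitting d F G z) : ∀ H ∈ splitFacets d F G z, 2 ≤ H.card :=
  fun H hH => by
    have := h.le_d
    rw [h.card_of_mem H hH]
    lia

lemma eq_of_subset (h : IsSplitting d F G z) :
    ∀ H ∈ splitFacets d F G z, ∀ H' ∈ splitFacets d F G z, H ⊆ H' → H = H' :=
  fun H hH H' hH' hs =>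
    Finset.eq_of_subset_of_card_le hs (by rw [h.card_of_mem H hH, h.card_of_mem H' hH'])

lemma symbSet_two (h : IsSplitting d F G z) :
    symbSet (splitFacets d F G z) 2 =
      uniformSet (F ∪ G) (d - 1) ∩ degGE (insert z F) 2 ∩ degGE (insert z G) 2 := by
  ext b
  constructor
  · intro hb
    refine ⟨⟨fun A hA hc => ?_, ?_⟩, ?_⟩
    · exact h.compl_insert A ▸ hb _ (h.insert_mem hA hc)
    · exact h.compl_right ▸ hb _ right_mem
    · exact h.compl_left ▸ hb _ left_mem
  · rintro ⟨⟨h1, h2⟩, h3⟩ H hH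
    rcases h.mem_cases hH with rfl | rfl | ⟨A, hA, hc, rfl⟩
    · exact h.compl_left ▸ h3
    · exact h.compl_right ▸ h2
    · exact h.compl_insert A ▸ h1 A hA hc

lemma isCM_symbPow_two (k : Type) [Field k] (h : IsSplitting d F G z) :
    isCM k (quotMod k (symbPow (srIdeal k (generatedComplex (splitFacets d F G z))) 2)) := by
  have hd := h.le_d
  obtain ⟨h1, h2⟩ := depthGE_secondPower k (by lia) h.card_eq h.disjoint h.notMem_left
    h.notMem_right h.card_left h.card_right
  rw [symbPow_srIdeal k h.eq_of_subset, isCM, h.symbSet_two, mdepth_quotMod_eq k h1 h2, modDim,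
    ← h.symbSet_two]
  have h3 := ringKrullDim_monQuot_symbSet k one_le_two ⟨F, left_mem⟩ h.card_of_mem
  rw [← h3]
  exact (congrArg (fun I : Ideal (MvPolynomial (Fin n) k) =>
    ringKrullDim (MvPolynomial (Fin n) k ⧸ I)) (Ideal.annihilator_quotient)).symm

lemma exists_socle_element (k : Type) [Field k] (h : IsSplitting d F G z) :
    ∃ x : PrimaryProd k (splitFacets d F G z) (d + 1) ⧸
        LinearMap.range (diag k (splitFacets d F G z) (d + 1)), x ≠ 0 ∧
      ∀ i, (X i : MvPolynomial (Fin n) k) • x = 0 := by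
  have hd := h.le_d
  have hFc : Fᶜ ∩ (F ∪ G) = G := by
    rw [h.compl_left]
    have h1 := Finset.disjoint_left.1 h.disjoint
    have h2 := h.notMem_left
    have h3 := h.notMem_right
    grind
  have hGc : Gᶜ ∩ (F ∪ G) = F := by
    rw [h.compl_right]
    have h1 := Finset.disjoint_left.1 h.disjoint
    have h2 := h.notMem_left
    have h3 := h.notMem_right
    grind
  have hadd {P : Finset (Fin n)} {i : Fin n} (hi : i ∈ P) :
      ∑ j ∈ P, (ind (F ∪ G) + Finsupp.single i 1 : Fin n →₀ ℕ) j = (P ∩ (F ∪ G)).card + 1 := by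
    rw [add_comm, sum_add_ind]
    simp [Finsupp.single_apply, hi, add_comm]
  refine SerrePaper.exists_socle_element (a := ind (F ∪ G)) (F := F) (G := G) left_mem right_mem
    h.left_ne_right ?_ ?_ fun i => ?_
  · rw [degGE, Set.mem_ofPred_eq, sum_ind, hFc, h.card_right]
    lia
  · rw [degGE, Set.mem_ofPred_eq, sum_ind, hGc, h.card_left]
    lia
  by_cases hi : i ∈ F
  · refine Or.inr fun H hH hHF => ?_
    rcases h.mem_cases hH with rfl | rfl | ⟨A, hA, hc, rfl⟩
    · exact absurd rfl hHF
    · rw [degGE, Set.mem_ofPred_eq, hadd (Finset.mem_compl.2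
        (Finset.disjoint_left.1 h.disjoint hi)), hGc, h.card_left]
    · refine isUpperSet_degGE _ _ le_self_add ?_
      rw [degGE, Set.mem_ofPred_eq, h.compl_insert, sum_ind,
        Finset.inter_eq_left.2 Finset.sdiff_subset, Finset.card_sdiff_of_subset hA,
        Finset.card_union_of_disjoint h.disjoint, h.card_left, h.card_right]
      lia
  · refine Or.inl ?_
    rw [degGE, Set.mem_ofPred_eq, hadd (Finset.mem_compl.2 hi), hFc, h.card_right]

lemma mdepth_symbPow_succ (k : Type) [Field k] (h : IsSplitting d F G z) :
    mdepth k (quotMod k (symbPow (srIdeal k (generatedComplex (splitFacets d F G z))) (d + 1)))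
      = 1 := by
  obtain ⟨x, hx, hx0⟩ := h.exists_socle_element k
  rw [symbPow_srIdeal k h.eq_of_subset]
  refine mdepth_quotMod_eq k (fun i hi => ?_) (ext_residue_one_nontrivial h.two_le_card hx hx0)
  rw [Nat.lt_one_iff.1 hi]
  exact ext_residue_zero_subsingleton h.two_le_card

lemma serreDepth_symbPow_succ (k : Type) [Field k] (h : IsSplitting d F G z) :
    serreDepth k 2
      (quotMod k (symbPow (srIdeal k (generatedComplex (splitFacets d F G z))) (d + 1))) = 1 := by
  obtain ⟨x, hx, hx0⟩ := h.exists_socle_element k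
  rw [symbPow_srIdeal k h.eq_of_subset]
  exact serreDepth_two_eq_one k (ext_self_top_subsingleton h.two_le_card)
    (ext_self_nontrivial (h.card_eq ▸ Nat.succ_pos _) h.two_le_card hx hx0)

end IsSplitting

end Facets

namespace IsSplitting

variable {n d : ℕ} {F G : Finset (Fin n)} {z : Fin n}

lemma sum_sdiff_add (h : IsSplitting d F G z) (b : Fin n →₀ ℕ) {A : Finset (Fin n)}
    (hA : A ⊆ F ∪ G) :
    ∑ i ∈ (F ∪ G) \ A, b i + ∑ i ∈ A, b i = ∑ i ∈ F, b i + ∑ i ∈ G, b i := by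
  rw [Finset.sum_sdiff hA, Finset.sum_union h.disjoint]

lemma sum_sdiff_erase (h : IsSplitting d F G z) (b : Fin n →₀ ℕ) {x : Fin n} (hx : x ∈ F) :
    ∑ i ∈ (F ∪ G) \ F.erase x, b i = b x + ∑ i ∈ G, b i := by
  have h1 := h.sum_sdiff_add b ((F.erase_subset x).trans Finset.subset_union_left)
  have h2 := Finset.sum_erase_add F b hx
  lia

lemma exists_meeting_left (h : IsSplitting d F G z) {b : Fin n →₀ ℕ}
    (hF : ∑ i ∈ G, b i < d + 2) {A : Finset (Fin n)} (hA : A ⊆ F ∪ G) (hc : A.card = d - 1)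
    (hbA : ∑ i ∈ (F ∪ G) \ A, b i < d + 2) :
    ∃ A' ⊆ F ∪ G, A'.card = d - 1 ∧ ∑ i ∈ (F ∪ G) \ A', b i < d + 2 ∧ (A' ∩ F).Nonempty := by
  by_contra! hno
  have hd := h.le_d
  have hAF : A ∩ F = ∅ := hno A hA hc hbA
  have hAG : A ⊆ G := fun i hi => (Finset.mem_union.1 (hA hi)).resolve_left fun hiF =>
    Finset.notMem_empty i (hAF ▸ Finset.mem_inter.2 ⟨hi, hiF⟩)
  have hno' {A' : Finset (Fin n)} {x : Fin n} (hs : A' ⊆ F ∪ G) (hc' : A'.card = d - 1)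
      (hxA : x ∈ A') (hxF : x ∈ F) : d + 2 ≤ ∑ i ∈ (F ∪ G) \ A', b i := by
    by_contra hlt
    exact Finset.notMem_empty x (hno A' hs hc' (not_le.1 hlt) ▸ Finset.mem_inter.2 ⟨hxA, hxF⟩)
  have hx1 : ∀ x ∈ F, 1 ≤ b x := by
    intro x hx
    have h1 : (F.erase x).card = d - 1 := by rw [Finset.card_erase_of_mem hx, h.card_left]
    obtain ⟨y, hy⟩ := Finset.card_pos.1 (by lia : 0 < (F.erase x).card)
    have h2 := hno' ((F.erase_subset x).trans Finset.subset_union_left) h1 hy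
      (Finset.mem_of_mem_erase hy)
    rw [h.sum_sdiff_erase b hx] at h2
    lia
  have hsum := h.sum_sdiff_add b hA
  have hswap : ∀ v ∈ A, ∀ x ∈ F, d + 2 + b x ≤ ∑ i ∈ (F ∪ G) \ A, b i + b v := by
    intro v hv x hx
    have hxA : x ∉ A.erase v := fun hxA =>
      Finset.disjoint_left.1 h.disjoint hx (hAG (Finset.mem_of_mem_erase hxA))
    have hs : insert x (A.erase v) ⊆ F ∪ G := Finset.insert_subset
      (Finset.mem_union_left G hx) ((A.erase_subset v).trans hA)
    have h1 := hno' hs (by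
      rw [Finset.card_insert_of_notMem hxA, Finset.card_erase_of_mem hv]
      lia) (Finset.mem_insert_self x _) hx
    have h2 := h.sum_sdiff_add b hs
    rw [Finset.sum_insert hxA] at h2
    have h3 := Finset.sum_erase_add A b hv
    lia
  have hv2 : ∀ v ∈ A, 2 ≤ b v := by
    intro v hv
    obtain ⟨x, hx⟩ := Finset.card_pos.1 (by rw [h.card_left]; lia : 0 < F.card)
    have h1 := hswap v hv x hx
    have h2 := hx1 x hx
    lia
  obtain ⟨v, hv⟩ := Finset.card_pos.1 (by lia : 0 < A.card)
  have h1 : (A.erase v).card * 2 ≤ ∑ i ∈ A.erase v, b i := by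
    simpa using Finset.card_nsmul_le_sum (A.erase v) b 2
      fun i hi => hv2 i (Finset.mem_of_mem_erase hi)
  rw [Finset.card_erase_of_mem hv] at h1
  have h2 := Finset.sum_erase_add A b hv
  have h3 : ∑ i ∈ A, b i ≤ ∑ i ∈ G, b i :=
    Finset.sum_le_sum_of_subset_of_nonneg hAG fun _ _ _ => Nat.zero_le _
  have h4 := hv2 v hv
  have h5 : ∑ i ∈ F, b i ≤ F.card * 1 := by
    simpa using Finset.sum_le_card_nsmul F b 1 fun x hx => by
      have := hswap v hv x hx
      lia
  rw [h.card_left] at h5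
  obtain ⟨x, hx⟩ := Finset.card_pos.1 (by rw [h.card_left]; lia : 0 < F.card)
  have h6 := hswap v hv x hx
  have h7 := hx1 x hx
  lia

lemma exists_card_of_left_right (h : IsSplitting d F G z) {b : Fin n →₀ ℕ}
    (hF : ∑ i ∈ G, b i < d + 2) (hG : ∑ i ∈ F, b i < d + 2) :
    ∃ A ⊆ F ∪ G, A.card = d - 1 ∧ ∑ i ∈ (F ∪ G) \ A, b i < d + 2 := by
  by_contra! hno
  have hd := h.le_d
  have key {F G : Finset (Fin n)} (h : IsSplitting d F G z)
      (hF : ∑ i ∈ G, b i < d + 2) (hG : ∑ i ∈ F, b i < d + 2)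
      (hno : ∀ A ⊆ F ∪ G, A.card = d - 1 → d + 2 ≤ ∑ i ∈ (F ∪ G) \ A, b i) :
      (∀ x ∈ F, 1 ≤ b x) ∧ d + 1 ≤ ∑ i ∈ G, b i := by
    have h1 : ∀ x ∈ F, d + 2 ≤ b x + ∑ i ∈ G, b i := fun x hx => by
      rw [← h.sum_sdiff_erase b hx]
      exact hno _ ((F.erase_subset x).trans Finset.subset_union_left)
        (by rw [Finset.card_erase_of_mem hx, h.card_left])
    refine ⟨fun x hx => ?_, ?_⟩
    · have := h1 x hx
      lia
    · by_contra hlt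
      have h2 : F.card * 2 ≤ ∑ i ∈ F, b i := by
        simpa using Finset.card_nsmul_le_sum F b 2 fun x hx => by
          have := h1 x hx
          lia
      rw [h.card_left] at h2
      lia
  obtain ⟨hxF, hgG⟩ := key h hF hG hno
  obtain ⟨hxG, hgF⟩ := key h.symm hG hF (by rwa [Finset.union_comm])
  have hbig {F : Finset (Fin n)} (hc : F.card = d) (hg : d + 1 ≤ ∑ i ∈ F, b i) :
      ∃ x ∈ F, 2 ≤ b x := by
    by_contra! hlt
    have h5 : ∑ i ∈ F, b i ≤ F.card * 1 := by
      simpa using Finset.sum_le_card_nsmul F b 1 fun x hx => Nat.le_of_lt_succ (hlt x hx)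
    lia
  obtain ⟨x, hx, hbx⟩ := hbig h.card_left hgF
  obtain ⟨y, hy, hby⟩ := hbig h.card_right hgG
  have hxy : x ≠ y := by
    rintro rfl
    exact Finset.disjoint_left.1 h.disjoint hx hy
  obtain ⟨A, hxyA, hA, hc⟩ := Finset.exists_subsuperset_card_eq
    (s := {x, y}) (t := F ∪ G) (n := d - 1)
    (Finset.insert_subset (Finset.mem_union_left G hx)
      (Finset.singleton_subset_iff.2 (Finset.mem_union_right F hy)))
    (by rw [Finset.card_pair hxy]; lia)
    (by rw [Finset.card_union_of_disjoint h.disjoint, h.card_left, h.card_right]; lia)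
  have h1 := hno A hA hc
  have h2 := h.sum_sdiff_add b hA
  have h3 := Finset.sum_sdiff (f := b) hxyA
  rw [Finset.sum_pair hxy] at h3
  have h4 : (A \ {x, y}).card * 1 ≤ ∑ i ∈ A \ {x, y}, b i := by
    simpa using Finset.card_nsmul_le_sum (A \ {x, y}) b 1 fun i hi =>
      (Finset.mem_union.1 (hA (Finset.mem_sdiff.1 hi).1)).elim (hxF i) (hxG i)
  rw [Finset.card_sdiff_of_subset hxyA, Finset.card_pair hxy, hc] at h4
  lia

lemma meetConnected (k : Type) [Field k] (h : IsSplitting d F G z) :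
    MeetConnected k (splitFacets d F G z) (d + 2) := by
  intro b φ hφ
  have hFb {F G : Finset (Fin n)} (h : IsSplitting d F G z) (hb : b ∉ degGE Fᶜ (d + 2)) :
      ∑ i ∈ G, b i < d + 2 := by
    rw [h.compl_left, degGE, Set.mem_ofPred_eq, Finset.sum_insert h.notMem_right] at hb
    lia
  have hAb (A : Finset (Fin n)) :
      b ∉ degGE (insert z A)ᶜ (d + 2) ↔ ∑ i ∈ (F ∪ G) \ A, b i < d + 2 := by
    rw [h.compl_insert, degGE, Set.mem_ofPred_eq, not_le]
  have hmeet {F' : Finset (Fin n)} (hF : F' ∈ splitFacets d F G z) (hbF : b ∉ degGE F'ᶜ (d + 2))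
      {A : Finset (Fin n)} (hA : insert z A ∈ splitFacets d F G z)
      (hbA : b ∉ degGE (insert z A)ᶜ (d + 2))
      (hex : ∃ A' ⊆ F ∪ G, A'.card = d - 1 ∧ ∑ i ∈ (F ∪ G) \ A', b i < d + 2 ∧
        (A' ∩ F').Nonempty) : φ ⟨F', hF⟩ = φ ⟨insert z A, hA⟩ := by
    obtain ⟨A', hA', hc', hbA', hne⟩ := hex
    refine (hφ _ ⟨insert z A', h.insert_mem hA' hc'⟩ hbF ((hAb A').2 hbA') ?_).trans
      (hφ _ _ ((hAb A').2 hbA') hbA ⟨z, Finset.mem_inter.2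
        ⟨Finset.mem_insert_self z A', Finset.mem_insert_self z A⟩⟩)
    obtain ⟨i, hi⟩ := hne
    exact ⟨i, by grind⟩
  have hz {A : Finset (Fin n)} (hs : A ⊆ F ∪ G) (hc : A.card = d - 1)
      (hA : insert z A ∈ splitFacets d F G z)
      (hbA : b ∉ degGE (insert z A)ᶜ (d + 2)) (H : {H // H ∈ splitFacets d F G z})
      (hbH : b ∉ degGE H.1ᶜ (d + 2)) : φ H = φ ⟨insert z A, hA⟩ := by
    obtain ⟨H, hH⟩ := H
    rcases h.mem_cases hH with rfl | rfl | ⟨A', hA', hc', rfl⟩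
    · exact hmeet hH hbH hA hbA (h.exists_meeting_left (hFb h hbH) hs hc ((hAb A).1 hbA))
    · refine hmeet hH hbH hA hbA ?_
      have h1 := h.symm.exists_meeting_left (hFb h.symm hbH) (A := A)
      simp only [Finset.union_comm H F] at h1
      exact h1 hs hc ((hAb A).1 hbA)
    · exact hφ _ _ hbH hbA ⟨z, Finset.mem_inter.2
        ⟨Finset.mem_insert_self z A', Finset.mem_insert_self z A⟩⟩
  by_cases hex : ∃ A ⊆ F ∪ G, A.card = d - 1 ∧ ∑ i ∈ (F ∪ G) \ A, b i < d + 2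
  · obtain ⟨A, hA, hc, hbA⟩ := hex
    intro H H' hbH hbH'
    exact (hz hA hc (h.insert_mem hA hc) ((hAb A).2 hbA) H hbH).trans
      (hz hA hc (h.insert_mem hA hc) ((hAb A).2 hbA) H' hbH').symm
  · rintro ⟨H, hH⟩ ⟨H', hH'⟩ hbH hbH'
    rcases h.mem_cases hH with rfl | rfl | ⟨A, hA, hc, rfl⟩
    · rcases h.mem_cases hH' with rfl | rfl | ⟨A', hA', hc', rfl⟩
      · rfl
      · exact absurd (h.exists_card_of_left_right (hFb h hbH) (hFb h.symm hbH')) hex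
      · exact absurd ⟨A', hA', hc', (hAb A').1 hbH'⟩ hex
    · rcases h.mem_cases hH' with rfl | rfl | ⟨A', hA', hc', rfl⟩
      · exact absurd (h.exists_card_of_left_right (hFb h hbH') (hFb h.symm hbH)) hex
      · rfl
      · exact absurd ⟨A', hA', hc', (hAb A').1 hbH'⟩ hex
    · exact absurd ⟨A, hA, hc, (hAb A).1 hbH⟩ hex

lemma two_le_mdepth_symbPow (k : Type) [Field k] (h : IsSplitting d F G z) :
    2 ≤ mdepth k
      (quotMod k (symbPow (srIdeal k (generatedComplex (splitFacets d F G z))) (d + 2))) := by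
  rw [symbPow_srIdeal k h.eq_of_subset]
  refine le_mdepth_quotMod k (fun b hb => ?_)
    fun i hi => ext_residue_of_meetConnected h.two_le_card (h.meetConnected k) hi
  have h1 : d + 2 ≤ ∑ i ∈ Fᶜ, b i := hb F left_mem
  have h2 : ∑ i ∈ Fᶜ, b i ≤ ∑ i, b i :=
    Finset.sum_le_sum_of_subset_of_nonneg (Finset.subset_univ _) fun _ _ _ => Nat.zero_le _
  rw [degGE, Set.mem_ofPred_eq]
  lia

lemma two_le_serreDepth_symbPow (k : Type) [Field k] (h : IsSplitting d F G z) :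
    2 ≤ serreDepth k 2
      (quotMod k (symbPow (srIdeal k (generatedComplex (splitFacets d F G z))) (d + 2))) := by
  have hn := h.card_eq
  rw [symbPow_srIdeal k h.eq_of_subset]
  refine two_le_serreDepth_two k (ext_self_top_subsingleton h.two_le_card)
    (ext_self_of_meetConnected h.two_le_card (h.meetConnected k) (by lia))
    (m := Fᶜᶜ.card) (card_compl_le_modDim_serreK k (c := (d + 2) • ind F) (ℓ := d + 2) (by lia)
      (h.compl_left ▸ Finset.insert_nonempty z G) (isUpperSet_symbSet _ _)
      (fun b hb => hb F left_mem) ?_ fun b hb H hH => ?_)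
  · rw [mem_degGE_one]
    rintro ⟨i, hi, h1⟩
    rw [Finsupp.smul_apply, ind_apply, if_neg (Finset.mem_compl.1 hi), smul_zero] at h1
    exact lt_irrefl 0 h1
  · by_cases hHF : F ⊆ H
    · rw [← h.eq_of_subset F left_mem H hH hHF]
      exact isUpperSet_degGE _ _ le_self_add hb
    · obtain ⟨x, hx, hxH⟩ := Finset.not_subset.1 hHF
      refine isUpperSet_degGE _ _ le_add_self ?_
      have h1 := Finset.single_le_sum (f := ((d + 2) • ind F : Fin n →₀ ℕ))
        (fun _ _ => Nat.zero_le _) (Finset.mem_compl.2 hxH)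
      rwa [Finsupp.smul_apply, ind_apply, if_pos hx, smul_eq_mul, mul_one] at h1

end IsSplitting

section Shelling

variable {n : ℕ}

/-- An exchange property making the decreasing colexicographic order a shelling. -/
lemma shellable_generatedComplex {Φ : Finset (Finset (Fin n))}
    (hΦ : ∀ H ∈ Φ, ∀ H' ∈ Φ, H ⊆ H' → H = H')
    (h : ∀ A ∈ Φ, ∀ B ∈ Φ, toColex A < toColex B →
      ∃ w ∈ A, w ∉ B ∧ ∃ A' ∈ Φ, toColex A < toColex A' ∧ A.erase w ⊆ A') :
    Shellable (generatedComplex Φ) := by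
  let s : Finset (Colex (Finset (Fin n))) := Φ.map toColex.toEmbedding
  have hs (x : Colex (Finset (Fin n))) : x ∈ s ↔ ofColex x ∈ Φ := by
    simp only [s, Finset.mem_map_equiv]
    rfl
  let e := s.orderEmbOfFin rfl
  have he (i : Fin s.card) : ofColex (e i) ∈ Φ := (hs _).1 (s.orderEmbOfFin_mem rfl i)
  have hsurj {A : Finset (Fin n)} (hA : A ∈ Φ) : ∃ i, e i = toColex A := by
    have h1 : toColex A ∈ Set.range e := by
      rw [Finset.range_orderEmbOfFin]
      exact (hs _).2 hA
    exact h1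
  refine ⟨s.card, fun i => ofColex (e i.rev), ?_, ?_, ?_⟩
  · exact fun i j hij => Fin.rev_injective (e.injective (ofColex.injective hij))
  · intro F
    rw [isFacet_generatedComplex hΦ]
    constructor
    · intro hF
      obtain ⟨i, hi⟩ := hsurj hF
      exact ⟨i.rev, by simp only [Fin.rev_rev, hi]; rfl⟩
    · rintro ⟨i, rfl⟩
      exact he _
  · rintro j - G ⟨⟨hGj, i, hij, hGi⟩, hmax⟩
    obtain ⟨w, hwA, hwB, A', hA', hlt, hsub⟩ := h _ (he j.rev) _ (he i.rev)
      (e.strictMono (Fin.rev_lt_rev.2 hij))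
    obtain ⟨l, hl⟩ := hsurj hA'
    have h1 : l.rev < j := by
      rw [← hl] at hlt
      have h2 : j.rev < l := e.strictMono.lt_iff_lt.1 hlt
      rwa [← Fin.rev_lt_rev, Fin.rev_rev] at h2
    have h2 := hmax ((ofColex (e j.rev)).erase w) ⟨Finset.erase_subset _ _, l.rev, h1, by
      simpa only [Fin.rev_rev, hl, ofColex_toColex] using hsub⟩ (Finset.subset_erase.2 ⟨hGj, fun hw => hwB (hGi hw)⟩)
    rw [← h2, Finset.card_erase_add_one hwA]

variable {d : ℕ} {F G : Finset (Fin n)} {z : Fin n}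

namespace IsSplitting

lemma shellable (h : IsSplitting d F G z) (hz : ∀ i, i ≤ z) :
    Shellable (generatedComplex (splitFacets d F G z)) := by
  refine shellable_generatedComplex h.eq_of_subset fun A hA B hB hlt => ?_
  have hAB : ¬ A ⊆ B := fun hs => hlt.ne (congrArg toColex (h.eq_of_subset A hA B hB hs))
  have key {w m : Fin n} (hw : w ∈ A) (hm : m ∉ A) (hwm : w < m)
      (hzm : z ∈ insert m (A.erase w)) : ∃ A' ∈ splitFacets d F G z,
        toColex A < toColex A' ∧ A.erase w ⊆ A' := by
    refine ⟨insert m (A.erase w), mem_splitFacets.2 (Or.inr (Or.inr ⟨hzm, ?_⟩)), ?_,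
      Finset.subset_insert _ _⟩
    · rw [Finset.card_insert_of_notMem fun hmA => hm (Finset.mem_of_mem_erase hmA),
        Finset.card_erase_add_one hw, h.card_of_mem A hA]
    · rw [Finset.Colex.toColex_lt_toColex_iff_exists_forall_lt]
      refine ⟨m, Finset.mem_insert_self _ _, hm, fun b hb hb' => ?_⟩
      have hbw : b = w := by
        by_contra hne
        exact hb' (Finset.mem_insert_of_mem (Finset.mem_erase.2 ⟨hne, hb⟩))
      exact hbw ▸ hwm
  obtain ⟨w, hwA, hwB⟩ := Finset.not_subset.1 hAB
  refine ⟨w, hwA, hwB, ?_⟩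
  by_cases hzA : z ∈ A
  · obtain ⟨m, hmB, hmA, hm⟩ := Finset.Colex.toColex_lt_toColex_iff_exists_forall_lt.1 hlt
    refine key hwA hmA (hm w hwA hwB) (Finset.mem_insert_of_mem (Finset.mem_erase.2 ⟨?_, hzA⟩))
    rintro rfl
    exact (hz m).not_gt (hm z hwA hwB)
  · exact key hwA hzA ((hz w).lt_of_ne fun hwz => hzA (hwz ▸ hwA)) (Finset.mem_insert_self _ _)

end IsSplitting

lemma isSplitting_fin (d : ℕ) (hd : 3 ≤ d) :
    IsSplitting (n := 2 * d + 1) d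
      ((Finset.range d).attachFin fun i hi => by
        rw [Finset.mem_range] at hi
        lia)
      ((Finset.Ico d (2 * d)).attachFin fun i hi => by
        rw [Finset.mem_Ico] at hi
        lia)
      (Fin.last (2 * d)) where
  le_d := hd
  disjoint := Finset.disjoint_left.2 fun i hi hi' => by
    rw [Finset.mem_attachFin, Finset.mem_range] at hi
    rw [Finset.mem_attachFin, Finset.mem_Ico] at hi'
    lia
  notMem_left := by
    rw [Finset.mem_attachFin, Finset.mem_range, Fin.val_last]
    lia
  notMem_right := by
    rw [Finset.mem_attachFin, Finset.mem_Ico, Fin.val_last]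
    lia
  card_left := by rw [Finset.card_attachFin, Finset.card_range]
  card_right := by
    rw [Finset.card_attachFin, Nat.card_Ico]
    lia
  cover := by
    ext i
    have h1 := i.2
    simp only [Finset.mem_insert, Finset.mem_union, Finset.mem_attachFin, Finset.mem_range,
      Finset.mem_Ico, Finset.mem_univ, iff_true, Fin.ext_iff, Fin.val_last]
    lia

end Shelling

/-- Theorem `CE of non-increasing`: for every `d ≥ 3` there is a
non-cone pure shellable simplicial complex `Δ` of dimension `d - 1` on `2d + 1` vertices
such that `S/I_Δ^(2)` is Cohen–Macaulay, `depth(S/I_Δ^(d+1)) = 1`,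
`depth(S/I_Δ^(d+2)) ≥ 2`, `S_2-depth(S/I_Δ^(d+1)) = 1` and
`S_2-depth(S/I_Δ^(d+2)) ≥ 2`.  In particular the depth and the `S_2`-Serre depth of the
symbolic powers of a Stanley–Reisner ideal need not be non-increasing. -/
theorem exists_shellable_symbPow_depth_not_nonincreasing
    (k : Type) [Field k] (d : ℕ) (hd : 3 ≤ d) :
    ∃ K : Set (Finset (Fin (2 * d + 1))), IsComplex K ∧ HasDimCard K d ∧
      (¬ ∃ v : Fin (2 * d + 1), ∀ F : Finset (Fin (2 * d + 1)), IsFacet K F → v ∈ F) ∧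
      Pure K ∧ Shellable K ∧
      isCM k (quotMod k (symbPow (srIdeal k K) 2)) ∧
      mdepth k (quotMod k (symbPow (srIdeal k K) (d + 1))) = 1 ∧
      2 ≤ mdepth k (quotMod k (symbPow (srIdeal k K) (d + 2))) ∧
      serreDepth k 2 (quotMod k (symbPow (srIdeal k K) (d + 1))) = 1 ∧
      2 ≤ serreDepth k 2 (quotMod k (symbPow (srIdeal k K) (d + 2))) := by
  have h := isSplitting_fin d hd
  refine ⟨generatedComplex (splitFacets d _ _ _), ⟨⟨∅, _, IsSplitting.left_mem, Finset.empty_subset _⟩, ?_⟩,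
    ⟨⟨_, ⟨_, IsSplitting.left_mem, subset_rfl⟩, h.card_left⟩, ?_⟩, ?_, ?_, h.shellable Fin.le_last,
    h.isCM_symbPow_two k, h.mdepth_symbPow_succ k, h.two_le_mdepth_symbPow k,
    h.serreDepth_symbPow_succ k, h.two_le_serreDepth_symbPow k⟩
  · rintro H ⟨H', hH', hs⟩ H'' hs'
    exact ⟨H', hH', hs'.trans hs⟩
  · rintro H ⟨H', hH', hs⟩
    exact (Finset.card_le_card hs).trans (h.card_of_mem H' hH').le
  · rintro ⟨v, hv⟩
    exact Finset.disjoint_left.1 h.disjoint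
      (hv _ ((isFacet_generatedComplex h.eq_of_subset _).2 IsSplitting.left_mem))
      (hv _ ((isFacet_generatedComplex h.eq_of_subset _).2 IsSplitting.right_mem))
  · intro H H' hH hH'
    rw [h.card_of_mem H ((isFacet_generatedComplex h.eq_of_subset _).1 hH),
      h.card_of_mem H' ((isFacet_generatedComplex h.eq_of_subset _).1 hH')]

end SerrePaper
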